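/- Let √(2x) < Q ≤ x be large and let 𝒜 = (a_n)_{n ≤ x} be a complex sequence satisfying the Progressions Condition (with parameter K_prog), the Non-concentration on Multiples condition (with parameters K_conc[H]), and the following Hereditarily Sparse condition: for some K_hered > 0, for every natural number h ≤ 2x/Q and every interval I of length Q/2, Σ_{n ∈ I} |a_{nh}| τ(n) ≤ (1/K_hered) · (Σ_{n ≤ x} |a_n|)² / (Σ_{n ≤ x} |a_n| τ₃(n)). Then V(𝒜,x,Q) = (Q/2) Σ_{n ≤ x} |a_n|² + O( (Σ_{n ≤ x} |a_n|)² · ( 1/K_prog + 1/K_conc[2x/Q] + log²(2x/Q)/K_hered ) + Σ_{n ≤ x} |a_n|² τ(n) ), with an absolute implied constant. -/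

import Mathlib

open scoped Classical

/-- `τ(n)`: the number of divisors of `n`. -/
def tau (n : ℕ) : ℕ := n.divisors.card

/-- `τ₃(n) := #{(u,v,w) ∈ ℕ³ : uvw = n}`, the threefold divisor function. -/
noncomputable def tau3 (n : ℕ) : ℕ := Nat.card {t : ℕ × ℕ × ℕ // t.1 * t.2.1 * t.2.2 = n}

/-- `𝒜(z;q,b) := Σ_{n ≤ z, n ≡ b (mod q)} a_n`, for a complex sequence `a`. -/
noncomputable def seqSum (a : ℕ → ℂ) (z : ℝ) (q b : ℕ) : ℂ :=
  ∑ n ∈ (Finset.Icc 1 ⌊z⌋₊).filter (fun n => n % q = b % q), a n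

/-- `Aver(𝒜,z;q,h) := (1/φ(q/h)) Σ_{1 ≤ b ≤ q, (b,q)=h} 𝒜(z;q,b)`, for `h ∣ q`. -/
noncomputable def seqAver (a : ℕ → ℂ) (z : ℝ) (q h : ℕ) : ℂ :=
  (1 / (Nat.totient (q / h) : ℂ)) *
    ∑ b ∈ (Finset.Icc 1 q).filter (fun b => Nat.gcd b q = h), seqSum a z q b

/-- The Barban–Davenport–Halberstam type variance
`V(𝒜,x,Q) := Σ_{Q/2 < q ≤ Q} Σ_{1 ≤ b ≤ q} |𝒜(x;q,b) − Aver(𝒜,x;q,(b,q))|²`. -/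
noncomputable def varV (a : ℕ → ℂ) (x Q : ℝ) : ℝ :=
  ∑ q ∈ Finset.Ioc ⌊Q / 2⌋₊ ⌊Q⌋₊, ∑ b ∈ Finset.Icc 1 q,
    ‖seqSum a x q b - seqAver a x q (Nat.gcd b q)‖ ^ 2

/-- The left-hand side of the Progressions Condition: `Σ_{1 ≤ r ≤ 2x/Q} Σ_{1 ≤ b ≤ r}
(Σ_{n ≤ x, n ≡ b (mod r)} |a_n|) · max_{z ≤ x} |𝒜(z;r,b) − Aver(𝒜,z;r,(b,r))|`. -/
noncomputable def progLHS (a : ℕ → ℂ) (x Q : ℝ) : ℝ :=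
  ∑ r ∈ Finset.Icc 1 ⌊2 * x / Q⌋₊, ∑ b ∈ Finset.Icc 1 r,
    (∑ n ∈ (Finset.Icc 1 ⌊x⌋₊).filter (fun n => n % r = b % r), ‖a n‖) *
      (⨆ z ∈ Set.Icc (0 : ℝ) x, ‖seqSum a z r b - seqAver a z r (Nat.gcd b r)‖)

/-- The left-hand side of the Non-concentration on Multiples condition:
`Σ_{H ≤ h ≤ Q} (Σ_{n ≤ x, h ∣ n} |a_n|)²`. -/
noncomputable def concLHS (a : ℕ → ℂ) (x Q H : ℝ) : ℝ :=
  ∑ h ∈ (Finset.Icc 1 ⌊Q⌋₊).filter (fun h : ℕ => H ≤ (h : ℝ)),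
    (∑ n ∈ (Finset.Icc 1 ⌊x⌋₊).filter (fun n => h ∣ n), ‖a n‖) ^ 2

open Finset

/-- `S` is, up to its endpoints, the set of natural numbers in the interval `[Y, 2Y]`. -/
def IsDyadicBlock (S : Finset ℕ) (Y : ℝ) : Prop :=
  (∀ f ∈ S, Y ≤ (f : ℝ) ∧ (f : ℝ) ≤ 2 * Y) ∧ ∀ f : ℕ, Y < f → (f : ℝ) < 2 * Y → f ∈ S

/-- The set of `f` with `d * f ∈ S`. -/
def quotSet (S : Finset ℕ) (d : ℕ) : Finset ℕ := (S.filter (d ∣ ·)).image (· / d)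

lemma mem_quotSet {S : Finset ℕ} {d f : ℕ} (hd : 0 < d) : f ∈ quotSet S d ↔ d * f ∈ S := by
  simp only [quotSet, mem_image, mem_filter]
  constructor
  · rintro ⟨s, ⟨hs, hds⟩, rfl⟩
    rwa [Nat.mul_div_cancel' hds]
  · intro h
    exact ⟨d * f, ⟨h, dvd_mul_right _ _⟩, Nat.mul_div_cancel_left _ hd⟩

lemma sum_quotSet {M : Type*} [AddCommMonoid M] (S : Finset ℕ) {d : ℕ} (hd : 0 < d) (F : ℕ → M) :
    ∑ f ∈ quotSet S d, F (d * f) = ∑ s ∈ S with d ∣ s, F s := by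
  refine sum_nbij' (fun f => d * f) (fun s => s / d) ?_ ?_ ?_ ?_ ?_
  · intro f hf
    exact mem_filter.2 ⟨(mem_quotSet hd).1 hf, dvd_mul_right _ _⟩
  · intro s hs
    rw [mem_filter] at hs
    rw [mem_quotSet hd, Nat.mul_div_cancel' hs.2]
    exact hs.1
  · intro f _
    exact Nat.mul_div_cancel_left _ hd
  · intro s hs
    exact Nat.mul_div_cancel' (mem_filter.1 hs).2
  · intro f _
    rfl

lemma quotSet_subset {S : Finset ℕ} {D d : ℕ} (hS : S ⊆ Icc 1 D) (hd : 0 < d) :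
    quotSet S d ⊆ Icc 1 D := by
  intro f hf
  have h := mem_Icc.1 (hS ((mem_quotSet hd).1 hf))
  rw [mem_Icc]
  refine ⟨Nat.pos_of_ne_zero ?_, (Nat.le_mul_of_pos_left f hd).trans h.2⟩
  rintro rfl
  simp at h

lemma IsDyadicBlock.dilate {S : Finset ℕ} {Y : ℝ} (hS : IsDyadicBlock S Y) {d : ℕ} (hd : 0 < d) :
    IsDyadicBlock (quotSet S d) (Y / d) := by
  have hd' : (0 : ℝ) < d := by exact_mod_cast hd
  constructor
  · intro f hf
    have h := hS.1 _ ((mem_quotSet hd).1 hf)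
    push_cast at h
    rw [div_le_iff₀ hd', ← mul_div_assoc, le_div_iff₀ hd']
    constructor <;> linarith [h.1, h.2]
  · intro f h1 h2
    rw [mem_quotSet hd]
    rw [div_lt_iff₀ hd'] at h1
    rw [← mul_div_assoc, lt_div_iff₀ hd'] at h2
    apply hS.2 <;> push_cast <;> linarith

lemma log_le_harmonic_sub {n : ℕ} (hn : n ≠ 0) :
    Real.log n + Real.eulerMascheroniConstant ≤ harmonic n ∧
      (harmonic n : ℝ) ≤ Real.log (n + 1) + Real.eulerMascheroniConstant := by
  have h1 := Real.eulerMascheroniSeq_lt_eulerMascheroniConstant n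
  have h2 := Real.eulerMascheroniConstant_lt_eulerMascheroniSeq' n
  rw [Real.eulerMascheroniSeq] at h1
  rw [Real.eulerMascheroniSeq', if_neg hn] at h2
  constructor <;> linarith

lemma abs_harmonic_floor_two_mul_sub {Y : ℝ} (hY : 1 ≤ Y) :
    |((harmonic ⌊2 * Y⌋₊ : ℝ) - harmonic ⌊Y⌋₊) - Real.log 2| ≤ 3 / Y := by
  set M := ⌊Y⌋₊
  set N := ⌊2 * Y⌋₊
  have hM1 : (M : ℝ) ≤ Y := Nat.floor_le (by linarith)
  have hM2 : Y < M + 1 := Nat.lt_floor_add_one Y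
  have hN1 : (N : ℝ) ≤ 2 * Y := Nat.floor_le (by linarith)
  have hN2 : 2 * Y < N + 1 := Nat.lt_floor_add_one _
  have hM0 : 1 ≤ M := Nat.le_floor (by simpa using hY)
  have hN0 : 1 ≤ N := Nat.le_floor (by push_cast; linarith)
  have hMr : (1 : ℝ) ≤ M := by exact_mod_cast hM0
  have hNr : (1 : ℝ) ≤ N := by exact_mod_cast hN0
  obtain ⟨a1, a2⟩ := log_le_harmonic_sub (n := M) (by omega)
  obtain ⟨b1, b2⟩ := log_le_harmonic_sub (n := N) (by omega)
  rw [abs_le]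
  constructor
  · have h : Real.log (2 * (M + 1) / N) ≤ 2 * (M + 1) / N - 1 :=
      Real.log_le_sub_one_of_pos (by positivity)
    rw [Real.log_div (by positivity) (by positivity),
      Real.log_mul (by norm_num) (by positivity)] at h
    have h3 : 2 * ((M : ℝ) + 1) / N - 1 ≤ 3 / Y := by
      rw [div_sub_one (by positivity), div_le_div_iff₀ (by positivity) (by positivity)]
      nlinarith
    linarith
  · have h : Real.log (((N : ℝ) + 1) / (2 * M)) ≤ (N + 1) / (2 * M) - 1 :=
      Real.log_le_sub_one_of_pos (by positivity)
    rw [Real.log_div (by positivity) (by positivity),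
      Real.log_mul (by norm_num) (by positivity)] at h
    have h3 : ((N : ℝ) + 1) / (2 * M) - 1 ≤ 3 / Y := by
      rw [div_sub_one (by positivity), div_le_div_iff₀ (by positivity) (by positivity)]
      nlinarith
    linarith

lemma sum_Ioc_inv_eq_harmonic_sub {M N : ℕ} (h : M ≤ N) :
    ∑ f ∈ Ioc M N, (1 : ℝ) / f = harmonic N - harmonic M := by
  have key : ∀ n : ℕ, (harmonic n : ℝ) = ∑ f ∈ Ioc 0 n, (1 : ℝ) / f := by
    intro n
    rw [harmonic_eq_sum_Icc]
    push_cast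
    simp only [one_div]
    rfl
  rw [key, key, ← sum_Ioc_consecutive _ (Nat.zero_le M) h]
  ring

lemma IsDyadicBlock.abs_sum_inv_sub_log {S : Finset ℕ} {Y : ℝ} (hS : IsDyadicBlock S Y)
    (hY : 0 < Y) : |∑ f ∈ S, (1 : ℝ) / f - Real.log 2| ≤ 10 / (1 + Y) := by
  have hl0 : 0 < Real.log 2 := Real.log_pos (by norm_num)
  have hl1 : Real.log 2 ≤ 1 := by linarith [Real.log_two_lt_d9]
  rcases lt_or_ge Y 1 with h1 | h1
  · have hsub : S ⊆ {1} := by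
      intro f hf
      have h := hS.1 f hf
      have h2 : (f : ℝ) < 2 := by linarith [h.2]
      have h3 : (0 : ℝ) < f := by linarith [h.1]
      have h2' : f < 2 := by exact_mod_cast h2
      have h3' : 0 < f := by exact_mod_cast h3
      rw [mem_singleton]
      omega
    have hle : ∑ f ∈ S, (1 : ℝ) / f ≤ 1 := by
      refine (sum_le_sum_of_subset_of_nonneg hsub fun _ _ _ => by positivity).trans ?_
      simp
    have hge : 0 ≤ ∑ f ∈ S, (1 : ℝ) / f := sum_nonneg fun _ _ => by positivity
    have : 1 ≤ 10 / (1 + Y) := by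
      rw [le_div_iff₀ (by positivity)]
      linarith
    rw [abs_le]
    constructor <;> linarith
  · set M := ⌊Y⌋₊ with hM
    set N := ⌊2 * Y⌋₊ with hN
    have hMN : M ≤ N := Nat.floor_le_floor (by linarith)
    have hM2 : Y < M + 1 := Nat.lt_floor_add_one Y
    have hN1 : (N : ℝ) ≤ 2 * Y := Nat.floor_le (by linarith)
    have hM1 : (M : ℝ) ≤ Y := Nat.floor_le (by linarith)
    have hM0 : 1 ≤ M := Nat.le_floor (by simpa using h1)
    have hN0 : 2 ≤ N := Nat.le_floor (by push_cast; linarith)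
    have hmain := abs_harmonic_floor_two_mul_sub h1
    rw [← hM, ← hN, ← sum_Ioc_inv_eq_harmonic_sub hMN] at hmain
    have hup : ∑ f ∈ S, (1 : ℝ) / f ≤ ∑ f ∈ Ioc M N, (1 : ℝ) / f + 2 / Y := by
      have hsub : S ⊆ insert M (Ioc M N) := by
        intro f hf
        have h := hS.1 f hf
        have h2 : f ≤ N := Nat.le_floor h.2
        have h3 : M ≤ f := by
          have : (M : ℝ) ≤ f := hM1.trans h.1
          exact_mod_cast this
        rw [mem_insert, mem_Ioc]
        omega
      refine (sum_le_sum_of_subset_of_nonneg hsub fun _ _ _ => by positivity).trans ?_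
      rw [sum_insert (by simp)]
      have : (1 : ℝ) / M ≤ 2 / Y := by
        have : (1 : ℝ) ≤ M := by exact_mod_cast hM0
        rw [div_le_div_iff₀ (by positivity) (by positivity)]
        linarith
      linarith
    have hlow : ∑ f ∈ Ioc M N, (1 : ℝ) / f ≤ ∑ f ∈ S, (1 : ℝ) / f + 1 / Y := by
      have hsub : Ioc M N ⊆ insert N S := by
        intro f hf
        rw [mem_Ioc] at hf
        rw [mem_insert]
        by_cases hfN : f = N
        · exact Or.inl hfN
        right
        have e1 : (M : ℝ) + 1 ≤ f := by exact_mod_cast hf.1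
        have e2 : (f : ℝ) + 1 ≤ N := by
          have : f + 1 ≤ N := by omega
          exact_mod_cast this
        exact hS.2 f (by linarith) (by linarith)
      refine (sum_le_sum_of_subset_of_nonneg hsub fun _ _ _ => by positivity).trans ?_
      have hNY : (1 : ℝ) / N ≤ 1 / Y := by
        have hN2 : 2 * Y < N + 1 := Nat.lt_floor_add_one _
        exact one_div_le_one_div_of_le (by positivity) (by linarith)
      by_cases hNS : N ∈ S
      · rw [insert_eq_of_mem hNS]
        have : 0 < 1 / Y := by positivity
        linarith
      · rw [sum_insert hNS]
        linarith
    have h5 : 5 / Y ≤ 10 / (1 + Y) := by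
      rw [div_le_div_iff₀ (by positivity) (by positivity)]
      linarith
    have e3 : 3 / Y + 2 / Y = 5 / Y := by ring
    have e1 : 1 / Y ≤ 2 / Y := by gcongr; norm_num
    rw [abs_le] at hmain ⊢
    constructor <;> linarith [hmain.1, hmain.2]

lemma IsDyadicBlock.sum_inv_le {S : Finset ℕ} {Y : ℝ} (hS : IsDyadicBlock S Y) (hY : 0 < Y) :
    ∑ f ∈ S, (1 : ℝ) / f ≤ 11 := by
  have h := (abs_le.1 (hS.abs_sum_inv_sub_log hY)).2
  have hl1 : Real.log 2 ≤ 1 := by linarith [Real.log_two_lt_d9]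
  have : 10 / (1 + Y) ≤ 10 := div_le_self (by norm_num) (by linarith)
  linarith

/-- The coefficients in the expansion `r / φ(r) = ∑_{d ∣ r} w(d)`. -/
noncomputable def totientWeight (d : ℕ) : ℝ := if Squarefree d then 1 / (d.totient : ℝ) else 0

lemma totientWeight_nonneg (d : ℕ) : 0 ≤ totientWeight d := by
  unfold totientWeight
  split_ifs <;> positivity

lemma totientWeight_le (d : ℕ) : totientWeight d ≤ 1 / (d.totient : ℝ) := by
  unfold totientWeight
  split_ifs
  · exact le_rfl
  · positivity

lemma totientWeight_le_one (d : ℕ) : totientWeight d ≤ 1 := by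
  refine (totientWeight_le d).trans ?_
  rcases Nat.eq_zero_or_pos d.totient with h | h
  · simp [h]
  · rw [div_le_one (by exact_mod_cast h)]
    exact_mod_cast h

lemma totient_eq_prod_of_squarefree {d : ℕ} (hd : Squarefree d) :
    (d.totient : ℝ) = ∏ p ∈ d.primeFactors, ((p : ℝ) - 1) := by
  have h := Nat.totient_mul_prod_primeFactors d
  rw [Nat.prod_primeFactors_of_squarefree hd, mul_comm] at h
  have h' := Nat.eq_of_mul_eq_mul_left (Nat.pos_of_ne_zero hd.ne_zero) h
  rw [h', Nat.cast_prod]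
  refine prod_congr rfl fun p hp => ?_
  rw [Nat.cast_sub (Nat.prime_of_mem_primeFactors hp).one_lt.le, Nat.cast_one]

lemma sum_divisors_totientWeight {r : ℕ} (hr : 0 < r) :
    ∑ d ∈ r.divisors, totientWeight d = r / r.totient := by
  have h1 : ∑ d ∈ r.divisors, totientWeight d
      = ∑ t ∈ r.primeFactors.powerset, ∏ p ∈ t, 1 / ((p : ℝ) - 1) := by
    simp only [totientWeight]
    rw [← sum_filter]
    refine sum_nbij' (fun d => d.primeFactors) (fun t => ∏ p ∈ t, p) ?_ ?_ ?_ ?_ ?_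
    · intro d hd
      rw [mem_filter, Nat.mem_divisors] at hd
      exact mem_powerset.2 (Nat.primeFactors_mono hd.1.1 hd.1.2)
    · intro t ht
      rw [mem_powerset] at ht
      rw [mem_filter, Nat.mem_divisors]
      refine ⟨⟨(prod_dvd_prod_of_subset _ _ _ ht).trans (Nat.prod_primeFactors_dvd r), hr.ne'⟩, ?_⟩
      refine squarefree_prod_of_pairwise_isCoprime (fun p hp q hq hpq => ?_)
        fun p hp => (Nat.prime_of_mem_primeFactors (ht hp)).squarefree
      rw [Function.onFun, Nat.coprime_iff_isRelPrime.symm]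
      exact (Nat.coprime_primes (Nat.prime_of_mem_primeFactors (ht hp))
        (Nat.prime_of_mem_primeFactors (ht hq))).2 hpq
    · intro d hd
      exact Nat.prod_primeFactors_of_squarefree (mem_filter.1 hd).2
    · intro t ht
      exact Nat.primeFactors_prod fun p hp =>
        Nat.prime_of_mem_primeFactors (mem_powerset.1 ht hp)
    · intro d hd
      rw [totient_eq_prod_of_squarefree (mem_filter.1 hd).2]
      simp
  rw [h1, ← prod_one_add]
  have h2 := Nat.totient_mul_prod_primeFactors r
  have hpos : (0 : ℝ) < r.totient := by exact_mod_cast Nat.totient_pos.2 hr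
  have h3 : (r.totient : ℝ) * ∏ p ∈ r.primeFactors, (p : ℝ)
      = r * ∏ p ∈ r.primeFactors, ((p : ℝ) - 1) := by
    have : ∏ p ∈ r.primeFactors, ((p : ℝ) - 1) = ((∏ p ∈ r.primeFactors, (p - 1) : ℕ) : ℝ) := by
      rw [Nat.cast_prod]
      refine prod_congr rfl fun p hp => ?_
      rw [Nat.cast_sub (Nat.prime_of_mem_primeFactors hp).one_lt.le, Nat.cast_one]
    rw [this, ← Nat.cast_prod, ← Nat.cast_mul, ← Nat.cast_mul, h2]
  have hprod : (0 : ℝ) < ∏ p ∈ r.primeFactors, ((p : ℝ) - 1) := by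
    refine prod_pos fun p hp => ?_
    have : (1 : ℝ) < p := by exact_mod_cast (Nat.prime_of_mem_primeFactors hp).one_lt
    linarith
  have h4 : ∏ p ∈ r.primeFactors, (1 + 1 / ((p : ℝ) - 1))
      = (∏ p ∈ r.primeFactors, (p : ℝ)) / ∏ p ∈ r.primeFactors, ((p : ℝ) - 1) := by
    rw [← prod_div_distrib]
    refine prod_congr rfl fun p hp => ?_
    have : (1 : ℝ) < p := by exact_mod_cast (Nat.prime_of_mem_primeFactors hp).one_lt
    have : (p : ℝ) - 1 ≠ 0 := by linarith
    field_simp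
    ring
  rw [h4, div_eq_div_iff hprod.ne' hpos.ne']
  linarith

lemma one_div_totient_eq {r : ℕ} (hr : 0 < r) :
    1 / (r.totient : ℝ) = ∑ d ∈ r.divisors, totientWeight d / r := by
  rw [← sum_div, sum_divisors_totientWeight hr]
  have : (r : ℝ) ≠ 0 := by positivity
  field_simp

lemma divisors_eq_filter_Icc {s D : ℕ} (hs : s ∈ Icc 1 D) :
    s.divisors = (Icc 1 D).filter (· ∣ s) := by
  rw [mem_Icc] at hs
  ext d
  rw [Nat.mem_divisors, mem_filter, mem_Icc]
  constructor
  · rintro ⟨h, -⟩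
    have := Nat.le_of_dvd (by omega) h
    have := Nat.pos_of_dvd_of_pos h (by omega)
    exact ⟨by omega, h⟩
  · rintro ⟨-, h⟩
    exact ⟨h, by omega⟩

lemma sum_mul_inv_totient_eq {S : Finset ℕ} {D : ℕ} (hS : S ⊆ Icc 1 D) (G : ℕ → ℝ) :
    ∑ s ∈ S, G s * (1 / (s.totient : ℝ))
      = ∑ d ∈ Icc 1 D, ∑ f ∈ quotSet S d, totientWeight d / (d * f) * G (d * f) := by
  have h1 : ∀ s ∈ S, G s * (1 / (s.totient : ℝ))
      = ∑ d ∈ Icc 1 D, if d ∣ s then totientWeight d / s * G s else 0 := by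
    intro s hs
    rw [one_div_totient_eq (mem_Icc.1 (hS hs)).1, divisors_eq_filter_Icc (hS hs), mul_sum,
      sum_filter]
    refine sum_congr rfl fun d _ => ?_
    split_ifs
    · ring
    · rfl
  rw [sum_congr rfl h1, sum_comm]
  refine sum_congr rfl fun d hd => ?_
  rw [← sum_filter, ← sum_quotSet S (mem_Icc.1 hd).1]
  refine sum_congr rfl fun f _ => ?_
  push_cast
  rfl

lemma sum_Icc_inv_sq_le (D : ℕ) : ∑ f ∈ Icc 1 D, 1 / ((f : ℝ) * f) ≤ 2 := by
  have h := sum_Ioo_inv_sq_le (α := ℝ) 0 (D + 1)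
  have e : Ioo 0 (D + 1) = Icc 1 D := by
    ext
    simp only [mem_Ioo, mem_Icc]
    omega
  rw [e] at h
  norm_num at h
  refine le_of_eq_of_le (sum_congr rfl fun f _ => ?_) h
  rw [one_div, pow_two, mul_inv]

lemma sum_totientWeight_div_le (D : ℕ) : ∑ d ∈ Icc 1 D, totientWeight d / d ≤ 4 := by
  calc ∑ d ∈ Icc 1 D, totientWeight d / d
      ≤ ∑ d ∈ Icc 1 D, 1 / (d : ℝ) * (1 / (d.totient : ℝ)) := by
        refine sum_le_sum fun d _ => ?_
        rw [div_eq_mul_one_div, mul_comm]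
        exact mul_le_mul_of_nonneg_left (totientWeight_le d) (by positivity)
    _ ≤ ∑ e ∈ Icc 1 D, ∑ f ∈ Icc 1 D, 1 / ((e : ℝ) * e) * (1 / ((f : ℝ) * f)) := by
        rw [sum_mul_inv_totient_eq Subset.rfl fun d => 1 / (d : ℝ)]
        refine sum_le_sum fun e he => ?_
        refine (sum_le_sum fun f _ => ?_).trans
          (sum_le_sum_of_subset_of_nonneg (quotSet_subset Subset.rfl (mem_Icc.1 he).1)
            fun _ _ _ => by positivity)
        calc totientWeight e / (e * f) * (1 / ((e * f : ℕ) : ℝ))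
            ≤ 1 / (e * f) * (1 / ((e * f : ℕ) : ℝ)) := by
              gcongr
              exact totientWeight_le_one e
          _ = 1 / ((e : ℝ) * e) * (1 / ((f : ℝ) * f)) := by
              push_cast
              rw [div_mul_div_comm, div_mul_div_comm]
              ring
    _ = (∑ e ∈ Icc 1 D, 1 / ((e : ℝ) * e)) * ∑ f ∈ Icc 1 D, 1 / ((f : ℝ) * f) := by
        rw [sum_mul_sum]
    _ ≤ 2 * 2 := by
        gcongr
        · exact sum_Icc_inv_sq_le D
        · exact sum_Icc_inv_sq_le D
    _ = 4 := by norm_num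

/-- The error function `g_D(Y) = ∑_{f ≤ D} 1 / (f (f + Y))`, of order `log Y / Y`. -/
noncomputable def blockError (D : ℕ) (Y : ℝ) : ℝ := ∑ f ∈ Icc 1 D, 1 / ((f : ℝ) * (f + Y))

lemma blockError_nonneg (D : ℕ) {Y : ℝ} (hY : 0 ≤ Y) : 0 ≤ blockError D Y :=
  sum_nonneg fun _ _ => by positivity

lemma blockError_anti (D : ℕ) {Y Z : ℝ} (hY : 0 ≤ Y) (h : Y ≤ Z) :
    blockError D Z ≤ blockError D Y := by
  refine sum_le_sum fun f hf => ?_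
  have : (0 : ℝ) < f := by exact_mod_cast (mem_Icc.1 hf).1
  gcongr

lemma sum_totientWeight_div_add_le (D : ℕ) {Y : ℝ} (hY : 0 ≤ Y) :
    ∑ d ∈ Icc 1 D, totientWeight d / (d + Y) ≤ 4 * blockError D Y := by
  calc ∑ d ∈ Icc 1 D, totientWeight d / (d + Y)
      ≤ ∑ d ∈ Icc 1 D, 1 / ((d : ℝ) + Y) * (1 / (d.totient : ℝ)) := by
        refine sum_le_sum fun d _ => ?_
        rw [div_eq_mul_one_div, mul_comm]
        exact mul_le_mul_of_nonneg_left (totientWeight_le d) (by positivity)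
    _ ≤ ∑ e ∈ Icc 1 D, ∑ f ∈ Icc 1 D, totientWeight e / e * (1 / ((f : ℝ) * (f + Y))) := by
        rw [sum_mul_inv_totient_eq Subset.rfl fun d => 1 / ((d : ℝ) + Y)]
        refine sum_le_sum fun e he => ?_
        have hw := totientWeight_nonneg e
        refine (sum_le_sum fun f hf => ?_).trans
          (sum_le_sum_of_subset_of_nonneg (quotSet_subset Subset.rfl (mem_Icc.1 he).1)
            fun _ _ _ => by positivity)
        have he1 : (1 : ℝ) ≤ e := by exact_mod_cast (mem_Icc.1 he).1
        have hf1 : (1 : ℝ) ≤ f := by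
          exact_mod_cast (mem_Icc.1 (quotSet_subset Subset.rfl (mem_Icc.1 he).1 hf)).1
        calc totientWeight e / (e * f) * (1 / (((e * f : ℕ) : ℝ) + Y))
            ≤ totientWeight e / (e * f) * (1 / (f + Y)) := by
              push_cast
              gcongr
              nlinarith
          _ = totientWeight e / e * (1 / ((f : ℝ) * (f + Y))) := by
              rw [div_mul_div_comm, div_mul_div_comm]
              ring
    _ = (∑ e ∈ Icc 1 D, totientWeight e / e) * blockError D Y := by
        rw [blockError, sum_mul_sum]
    _ ≤ 4 * blockError D Y :=
        mul_le_mul_of_nonneg_right (sum_totientWeight_div_le D) (blockError_nonneg D hY)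

lemma IsDyadicBlock.pos {S : Finset ℕ} {Y : ℝ} (hS : IsDyadicBlock S Y) (hY : 0 < Y) :
    S ⊆ Icc 1 (S.sup id) := by
  intro f hf
  have h : (0 : ℝ) < f := hY.trans_le (hS.1 f hf).1
  exact mem_Icc.2 ⟨by exact_mod_cast h, le_sup (f := id) hf⟩

lemma IsDyadicBlock.sum_inv_totient_le {S : Finset ℕ} {Y : ℝ} (hS : IsDyadicBlock S Y)
    (hY : 0 < Y) : ∑ s ∈ S, 1 / (s.totient : ℝ) ≤ 44 := by
  have h := sum_mul_inv_totient_eq (hS.pos hY) fun _ => 1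
  simp only [one_mul, mul_one] at h
  rw [h]
  calc ∑ d ∈ Icc 1 (S.sup id), ∑ f ∈ quotSet S d, totientWeight d / (d * f)
      = ∑ d ∈ Icc 1 (S.sup id), totientWeight d / d * ∑ f ∈ quotSet S d, (1 : ℝ) / f := by
        refine sum_congr rfl fun d _ => ?_
        rw [mul_sum]
        refine sum_congr rfl fun f _ => ?_
        rw [div_mul_div_comm, mul_one]
    _ ≤ ∑ d ∈ Icc 1 (S.sup id), totientWeight d / d * 11 := by
        refine sum_le_sum fun d hd => ?_
        have hd0 := (mem_Icc.1 hd).1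
        have hd1 : (0 : ℝ) < d := by exact_mod_cast hd0
        exact mul_le_mul_of_nonneg_left ((hS.dilate hd0).sum_inv_le (by positivity))
          (div_nonneg (totientWeight_nonneg d) (by positivity))
    _ ≤ 4 * 11 := by
        rw [← sum_mul]
        exact mul_le_mul_of_nonneg_right (sum_totientWeight_div_le _) (by norm_num)
    _ = 44 := by norm_num

lemma sum_moebius_divisors_gcd {f k : ℕ} (hk : 0 < k) :
    (if f.Coprime k then (1 : ℝ) else 0)
      = ∑ g ∈ k.divisors, if g ∣ f then (ArithmeticFunction.moebius g : ℝ) else 0 := by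
  have h := congrArg (fun F : ArithmeticFunction ℤ => F (f.gcd k))
    ArithmeticFunction.coe_zeta_mul_moebius
  simp only [ArithmeticFunction.coe_zeta_mul_apply, ArithmeticFunction.one_apply] at h
  have e : (f.gcd k).divisors = k.divisors.filter (· ∣ f) := by
    ext g
    simp only [Nat.mem_divisors, mem_filter, Nat.dvd_gcd_iff]
    have h1 := (Nat.gcd_pos_of_pos_right f hk).ne'
    have h2 := hk.ne'
    tauto
  rw [e] at h
  rw [← sum_filter]
  have h' : ((∑ g ∈ k.divisors with g ∣ f, ArithmeticFunction.moebius g : ℤ) : ℝ)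
      = if f.gcd k = 1 then (1 : ℝ) else 0 := by
    rw [h]
    split_ifs <;> simp
  rw [Int.cast_sum] at h'
  rw [h']

lemma sum_coprime_inv_eq (T : Finset ℕ) {k : ℕ} (hk : 0 < k) :
    ∑ f ∈ T, (if f.Coprime k then (1 : ℝ) else 0) / f
      = ∑ g ∈ k.divisors, (ArithmeticFunction.moebius g : ℝ) / g *
          ∑ f ∈ quotSet T g, (1 : ℝ) / f := by
  simp only [sum_moebius_divisors_gcd hk, sum_div]
  rw [sum_comm]
  refine sum_congr rfl fun g hg => ?_
  simp only [ite_div, zero_div]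
  rw [← sum_filter, ← sum_quotSet T (Nat.pos_of_mem_divisors hg), mul_sum]
  refine sum_congr rfl fun f _ => ?_
  push_cast
  rw [div_mul_div_comm, mul_one]

lemma IsDyadicBlock.abs_sum_coprime_inv_sub {T : Finset ℕ} {Y : ℝ} (hT : IsDyadicBlock T Y)
    (hY : 0 < Y) {k : ℕ} (hk : 0 < k) :
    |∑ f ∈ T, (if f.Coprime k then (1 : ℝ) else 0) / f
        - Real.log 2 * ∑ g ∈ k.divisors, (ArithmeticFunction.moebius g : ℝ) / g|
      ≤ 10 * tau k / (1 + Y) := by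
  rw [sum_coprime_inv_eq T hk, mul_sum, ← sum_sub_distrib]
  refine (abs_sum_le_sum_abs _ _).trans ?_
  have h : ∀ g ∈ k.divisors, |(ArithmeticFunction.moebius g : ℝ) / g *
      ∑ f ∈ quotSet T g, (1 : ℝ) / f
        - Real.log 2 * ((ArithmeticFunction.moebius g : ℝ) / g)| ≤ 10 / (1 + Y) := by
    intro g hg
    have hg0 := Nat.pos_of_mem_divisors hg
    have hg1 : (1 : ℝ) ≤ g := by exact_mod_cast hg0
    have hb := (hT.dilate hg0).abs_sum_inv_sub_log (by positivity)
    have hm : |(ArithmeticFunction.moebius g : ℝ)| ≤ 1 := by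
      exact_mod_cast ArithmeticFunction.abs_moebius_le_one (n := g)
    rw [mul_comm (Real.log 2), ← mul_sub, abs_mul, abs_div, Nat.abs_cast]
    calc |(ArithmeticFunction.moebius g : ℝ)| / g *
          |∑ f ∈ quotSet T g, (1 : ℝ) / f - Real.log 2|
        ≤ 1 / g * (10 / (1 + Y / g)) := by gcongr
      _ = 10 / (g + Y) := by field_simp
      _ ≤ 10 / (1 + Y) := by gcongr
  refine (sum_le_card_nsmul _ _ _ h).trans (le_of_eq ?_)
  rw [nsmul_eq_mul, tau]
  ring

lemma sum_coprime_inv_totient_eq {S : Finset ℕ} {D : ℕ} (hS : S ⊆ Icc 1 D) (k : ℕ) :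
    ∑ s ∈ S with s.Coprime k, 1 / (s.totient : ℝ)
      = ∑ d ∈ Icc 1 D, (if d.Coprime k then totientWeight d / d else 0) *
          ∑ f ∈ quotSet S d, (if f.Coprime k then (1 : ℝ) else 0) / f := by
  have h := sum_mul_inv_totient_eq hS fun s => if s.Coprime k then (1 : ℝ) else 0
  simp only [ite_mul, one_mul, zero_mul, ← sum_filter] at h
  rw [h]
  refine sum_congr rfl fun d _ => ?_
  rw [mul_sum]
  refine sum_congr rfl fun f _ => ?_
  simp only [Nat.coprime_mul_iff_left]
  by_cases h1 : d.Coprime k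
  · by_cases h2 : f.Coprime k
    · rw [if_pos ⟨h1, h2⟩, if_pos h1, if_pos h2, div_mul_div_comm, mul_one, mul_one]
    · rw [if_neg fun h => h2 h.2, if_neg h2, mul_zero, zero_div, mul_zero]
  · rw [if_neg fun h => h1 h.1, if_neg h1, mul_zero, zero_mul]

lemma abs_sum_coprime_inv_totient_sub_le {S T : Finset ℕ} {D : ℕ} {Y Z : ℝ}
    (hSD : S ⊆ Icc 1 D) (hTD : T ⊆ Icc 1 D) (hS : IsDyadicBlock S Y) (hT : IsDyadicBlock T Z)
    (hY : 0 < Y) (hZ : 0 < Z) {k : ℕ} (hk : 0 < k) :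
    |∑ s ∈ S with s.Coprime k, 1 / (s.totient : ℝ) - ∑ s ∈ T with s.Coprime k, 1 / (s.totient : ℝ)|
      ≤ 40 * tau k * (blockError D Y + blockError D Z) := by
  rw [sum_coprime_inv_totient_eq hSD, sum_coprime_inv_totient_eq hTD, ← sum_sub_distrib]
  refine (abs_sum_le_sum_abs _ _).trans ?_
  calc _ ≤ ∑ d ∈ Icc 1 D, 10 * (tau k : ℝ) *
        (totientWeight d / (d + Y) + totientWeight d / (d + Z)) := by
        refine sum_le_sum fun d hd => ?_
        have hd0 := (mem_Icc.1 hd).1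
        have hd1 : (0 : ℝ) < d := by exact_mod_cast hd0
        have hw := totientWeight_nonneg d
        have h1 := (hS.dilate hd0).abs_sum_coprime_inv_sub (div_pos hY hd1) hk
        have h2 := (hT.dilate hd0).abs_sum_coprime_inv_sub (div_pos hZ hd1) hk
        rw [← mul_sub, abs_mul]
        have h3 := (abs_sub_le _ (Real.log 2 *
          ∑ g ∈ k.divisors, (ArithmeticFunction.moebius g : ℝ) / g) _).trans
          (add_le_add h1 ((abs_sub_comm _ _).trans_le h2))
        have h4 : |if d.Coprime k then totientWeight d / d else 0| ≤ totientWeight d / d := by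
          split_ifs
          · rw [abs_of_nonneg (by positivity)]
          · rw [abs_zero]
            positivity
        refine (mul_le_mul h4 h3 (abs_nonneg _) (by positivity)).trans (le_of_eq ?_)
        field_simp
    _ = 10 * tau k * (∑ d ∈ Icc 1 D, totientWeight d / (d + Y)
          + ∑ d ∈ Icc 1 D, totientWeight d / (d + Z)) := by
        rw [← mul_sum, sum_add_distrib]
    _ ≤ 10 * tau k * (4 * blockError D Y + 4 * blockError D Z) := by
        gcongr
        · exact sum_totientWeight_div_add_le D hY.le
        · exact sum_totientWeight_div_add_le D hZ.le
    _ = 40 * tau k * (blockError D Y + blockError D Z) := by ring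

lemma sum_range_blockError_le (D J : ℕ) :
    ∑ j ∈ range (J + 1), blockError D ((j : ℝ) / 2) ≤ 2 * (harmonic (J + 1) : ℝ) ^ 2 + 4 := by
  have hharm : ∀ n : ℕ, (harmonic n : ℝ) = ∑ j ∈ range n, 1 / (1 + (j : ℝ)) := by
    intro n
    rw [harmonic]
    push_cast
    exact sum_congr rfl fun j _ => by rw [one_div, add_comm]
  have hsmall : ∑ f ∈ Icc 1 J, ∑ j ∈ range (J + 1), 1 / ((f : ℝ) * (f + (j : ℝ) / 2))
      ≤ 2 * (harmonic (J + 1) : ℝ) ^ 2 := by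
    calc ∑ f ∈ Icc 1 J, ∑ j ∈ range (J + 1), 1 / ((f : ℝ) * (f + (j : ℝ) / 2))
        ≤ ∑ f ∈ Icc 1 J, ∑ j ∈ range (J + 1), 1 / (f : ℝ) * (2 * (1 / (1 + (j : ℝ)))) := by
          refine sum_le_sum fun f hf => sum_le_sum fun j _ => ?_
          have hf1 : (1 : ℝ) ≤ f := by exact_mod_cast (mem_Icc.1 hf).1
          rw [mul_one_div, div_mul_div_comm, one_mul, div_le_div_iff₀ (by positivity) (by positivity)]
          have : (0 : ℝ) ≤ j := by positivity
          nlinarith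
      _ = (harmonic J : ℝ) * (2 * harmonic (J + 1)) := by
          rw [hharm (J + 1), mul_sum, harmonic_eq_sum_Icc]
          push_cast
          rw [sum_mul_sum]
          simp only [one_div]
      _ ≤ harmonic (J + 1) * (2 * harmonic (J + 1)) := by
          have h0 : (0 : ℝ) ≤ harmonic (J + 1) := by
            rw [hharm]
            exact sum_nonneg fun _ _ => by positivity
          have h1 : (harmonic J : ℝ) ≤ harmonic (J + 1) := by
            rw [harmonic_succ]
            push_cast
            have : (0 : ℝ) ≤ ((J : ℝ) + 1)⁻¹ := by positivity
            linarith
          gcongr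
      _ = 2 * (harmonic (J + 1) : ℝ) ^ 2 := by ring
  have hlarge : ∑ f ∈ Ioo J (D + 1), ∑ j ∈ range (J + 1), 1 / ((f : ℝ) * (f + (j : ℝ) / 2)) ≤ 4 := by
    calc ∑ f ∈ Ioo J (D + 1), ∑ j ∈ range (J + 1), 1 / ((f : ℝ) * (f + (j : ℝ) / 2))
        ≤ ∑ f ∈ Ioo J (D + 1), ∑ _j ∈ range (J + 1), ((f : ℝ) ^ 2)⁻¹ := by
          refine sum_le_sum fun f hf => sum_le_sum fun j _ => ?_
          have hf1 : (0 : ℝ) < f := by exact_mod_cast (Nat.zero_le J).trans_lt (mem_Ioo.1 hf).1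
          rw [← one_div, pow_two]
          gcongr
          have : (0 : ℝ) ≤ (j : ℝ) / 2 := by positivity
          linarith
      _ = ((J : ℝ) + 1) * ∑ f ∈ Ioo J (D + 1), ((f : ℝ) ^ 2)⁻¹ := by
          rw [mul_sum]
          refine sum_congr rfl fun f _ => ?_
          rw [sum_const, card_range, nsmul_eq_mul]
          push_cast
          rfl
      _ ≤ ((J : ℝ) + 1) * (2 / (J + 1)) := by
          gcongr
          exact sum_Ioo_inv_sq_le J (D + 1)
      _ ≤ 4 := by
          rw [mul_div_cancel₀ _ (by positivity)]
          norm_num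
  simp only [blockError]
  rw [sum_comm]
  have hsub : Icc 1 D ⊆ Icc 1 J ∪ Ioo J (D + 1) := by
    intro f hf
    simp only [mem_union, mem_Icc, mem_Ioo] at hf ⊢
    omega
  have hnn : ∀ f : ℕ, 0 ≤ ∑ j ∈ range (J + 1), 1 / ((f : ℝ) * (f + (j : ℝ) / 2)) :=
    fun f => sum_nonneg fun _ _ => by positivity
  refine (sum_le_sum_of_subset_of_nonneg hsub fun f _ _ => hnn f).trans ?_
  rw [sum_union]
  · linarith
  · rw [disjoint_left]
    intro f h1 h2
    rw [mem_Icc] at h1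
    rw [mem_Ioo] at h2
    omega

lemma sum_range_blockError_le_log_sq (D : ℕ) {R : ℝ} (hR : 2 ≤ R) :
    ∑ j ∈ range (⌊R⌋₊ + 1), blockError D ((j : ℝ) / 2) ≤ 50 * Real.log R ^ 2 := by
  have hl : 0.69 ≤ Real.log R := by
    have := Real.log_le_log (by norm_num) hR
    linarith [Real.log_two_gt_d9]
  have hfl : (⌊R⌋₊ : ℝ) ≤ R := Nat.floor_le (by linarith)
  have hH : (harmonic (⌊R⌋₊ + 1) : ℝ) ≤ 4 * Real.log R := by
    refine (harmonic_le_one_add_log _).trans ?_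
    have h1 : Real.log ((⌊R⌋₊ + 1 : ℕ) : ℝ) ≤ Real.log (2 * R) := by
      refine Real.log_le_log (by positivity) ?_
      push_cast
      linarith
    rw [Real.log_mul (by norm_num) (by linarith)] at h1
    linarith [Real.log_two_lt_d9]
  have hH0 : (0 : ℝ) ≤ harmonic (⌊R⌋₊ + 1) := by
    exact_mod_cast (harmonic_pos (by omega)).le
  refine (sum_range_blockError_le D ⌊R⌋₊).trans ?_
  nlinarith

/-- The normalised indicator of the relation `(m, q) = (n, q)`. -/
noncomputable def gcdKernel (q m n : ℕ) : ℝ :=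
  if m.gcd q = n.gcd q then 1 / ((q / m.gcd q).totient : ℝ) else 0

/-- The indicator of `m ≡ n (mod q)` minus the normalised indicator of `(m, q) = (n, q)`. -/
noncomputable def devKernel (q m n : ℕ) : ℝ :=
  (if n % q = m % q then 1 else 0) - gcdKernel q m n

lemma gcdKernel_nonneg (q m n : ℕ) : 0 ≤ gcdKernel q m n := by
  unfold gcdKernel
  split_ifs <;> positivity

lemma gcdKernel_comm (q m n : ℕ) : gcdKernel q m n = gcdKernel q n m := by
  unfold gcdKernel
  by_cases h : m.gcd q = n.gcd q
  · rw [if_pos h, if_pos h.symm, h]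
  · rw [if_neg h, if_neg (Ne.symm h)]

lemma devKernel_comm (q m n : ℕ) : devKernel q m n = devKernel q n m := by
  simp only [devKernel, gcdKernel_comm q m n, eq_comm]

lemma mod_gcd (b q : ℕ) : (b % q).gcd q = b.gcd q := by
  rw [← Nat.gcd_rec, Nat.gcd_comm]

lemma gcdKernel_mod (q b n : ℕ) : gcdKernel q (b % q) n = gcdKernel q b n := by
  simp only [gcdKernel, mod_gcd]

lemma devKernel_mod (q b n : ℕ) : devKernel q (b % q) n = devKernel q b n := by
  simp only [devKernel, gcdKernel_mod, Nat.mod_mod]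

lemma gcdKernel_le_one (q m n : ℕ) : gcdKernel q m n ≤ 1 := by
  unfold gcdKernel
  split_ifs
  · rcases Nat.eq_zero_or_pos (q / m.gcd q).totient with h | h
    · simp [h]
    · rw [div_le_one (by exact_mod_cast h)]
      exact_mod_cast h
  · norm_num

lemma abs_devKernel_le_one (q m n : ℕ) : |devKernel q m n| ≤ 1 := by
  have h0 := gcdKernel_nonneg q m n
  have h1 := gcdKernel_le_one q m n
  rw [devKernel, abs_le]
  split_ifs <;> constructor <;> linarith

lemma sum_Icc_eq_sum_range_of_mod {M : Type*} [AddCommGroup M] (f : ℕ → M) {q : ℕ}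
    (hf : ∀ b, f (b % q) = f b) : ∑ b ∈ Icc 1 q, f b = ∑ b ∈ range q, f b := by
  have h1 : ∑ b ∈ Icc 1 q, f b = ∑ b ∈ range q, f (b + 1) := by
    rw [range_eq_Ico, sum_Ico_add' f 0 q 1]
    rfl
  have h2 : f q = f 0 := by
    rw [← hf q, Nat.mod_self]
  have h3 := sum_range_succ' f q
  rw [sum_range_succ, h2] at h3
  rw [h1]
  exact (add_right_cancel h3).symm

lemma sum_Icc_ite_mod {M : Type*} [AddCommGroup M] (F : ℕ → M) {q : ℕ} (hq : 0 < q)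
    (hF : ∀ b, F (b % q) = F b) (n : ℕ) :
    ∑ b ∈ Icc 1 q, (if n % q = b % q then F b else 0) = F n := by
  rw [sum_Icc_eq_sum_range_of_mod]
  · rw [sum_eq_single (n % q)]
    · rw [Nat.mod_mod, if_pos rfl, hF]
    · intro b hb hne
      rw [Nat.mod_eq_of_lt (mem_range.1 hb), if_neg (Ne.symm hne)]
    · intro h
      exact absurd (mem_range.2 (Nat.mod_lt n hq)) h
  · intro b
    rw [Nat.mod_mod, hF]

lemma card_Icc_gcd_eq {q h : ℕ} (hq : h ∣ q) :
    ((Icc 1 q).filter fun b => b.gcd q = h).card = (q / h).totient := by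
  rw [Nat.totient_div_of_dvd hq]
  zify
  rw [card_filter, card_filter]
  push_cast
  rw [sum_Icc_eq_sum_range_of_mod]
  · simp only [Nat.gcd_comm]
  · intro b
    rw [mod_gcd]

lemma sum_gcdKernel_mul {q : ℕ} (hq : 0 < q) (m n : ℕ) :
    ∑ b ∈ Icc 1 q, gcdKernel q b m * gcdKernel q b n = gcdKernel q m n := by
  have h1 : ∀ b ∈ Icc 1 q, gcdKernel q b m * gcdKernel q b n
      = if b.gcd q = m.gcd q then
          gcdKernel q m n * (1 / ((q / m.gcd q).totient : ℝ)) else 0 := by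
    intro b _
    by_cases h : b.gcd q = m.gcd q
    · by_cases h' : m.gcd q = n.gcd q <;> simp [gcdKernel, h, h']
    · simp [gcdKernel, h]
  have hpos : (0 : ℝ) < ((q / m.gcd q).totient : ℝ) := by
    have hd := Nat.gcd_dvd_right m q
    exact_mod_cast Nat.totient_pos.2 (Nat.div_pos (Nat.le_of_dvd hq hd) (Nat.pos_of_dvd_of_pos hd hq))
  rw [sum_congr rfl h1, ← sum_filter, sum_const, card_Icc_gcd_eq (Nat.gcd_dvd_right m q),
    nsmul_eq_mul]
  field_simp

lemma sum_devKernel_mul {q : ℕ} (hq : 0 < q) (m n : ℕ) :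
    ∑ b ∈ Icc 1 q, devKernel q b m * devKernel q b n = devKernel q m n := by
  have h1 : ∑ b ∈ Icc 1 q, (if m % q = b % q then devKernel q b n else 0) = devKernel q m n :=
    sum_Icc_ite_mod _ hq (fun b => devKernel_mod q b n) m
  have h2 : ∑ b ∈ Icc 1 q, (if n % q = b % q then gcdKernel q b m else 0) = gcdKernel q n m :=
    sum_Icc_ite_mod _ hq (fun b => gcdKernel_mod q b m) n
  have h3 := sum_gcdKernel_mul hq m n
  have h4 : ∀ b ∈ Icc 1 q, devKernel q b m * devKernel q b n
      = (if m % q = b % q then devKernel q b n else 0)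
        - (if n % q = b % q then gcdKernel q b m else 0)
        + gcdKernel q b m * gcdKernel q b n := by
    intro b _
    simp only [devKernel]
    split_ifs <;> ring
  rw [sum_congr rfl h4, sum_add_distrib, sum_sub_distrib, h1, h2, h3, gcdKernel_comm q n m]
  ring

lemma seqSum_sub_seqAver (a : ℕ → ℂ) (z : ℝ) {q : ℕ} (hq : 0 < q) (b : ℕ) :
    seqSum a z q b - seqAver a z q (b.gcd q)
      = ∑ n ∈ Icc 1 ⌊z⌋₊, a n * (devKernel q b n : ℂ) := by
  have h1 : ∑ b' ∈ (Icc 1 q).filter (fun b' => b'.gcd q = b.gcd q), seqSum a z q b'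
      = ∑ n ∈ Icc 1 ⌊z⌋₊, if n.gcd q = b.gcd q then a n else 0 := by
    simp only [seqSum, sum_filter]
    have : ∀ b' ∈ Icc 1 q, (if b'.gcd q = b.gcd q then
        ∑ n ∈ Icc 1 ⌊z⌋₊, (if n % q = b' % q then a n else 0) else 0)
        = ∑ n ∈ Icc 1 ⌊z⌋₊, if n % q = b' % q then (if b'.gcd q = b.gcd q then a n else 0) else 0 := by
      intro b' _
      by_cases h : b'.gcd q = b.gcd q <;> simp [h]
    rw [sum_congr rfl this, sum_comm]
    refine sum_congr rfl fun n _ => ?_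
    exact sum_Icc_ite_mod (fun b' => if b'.gcd q = b.gcd q then a n else 0) hq
      (fun b' => by simp only [mod_gcd]) n
  rw [seqAver, h1, seqSum, sum_filter, mul_sum, ← sum_sub_distrib]
  refine sum_congr rfl fun n _ => ?_
  simp only [devKernel, gcdKernel, eq_comm (a := b.gcd q)]
  split_ifs <;> push_cast <;> ring

open ComplexConjugate in
lemma sum_norm_seqSum_sub_seqAver_sq (a : ℕ → ℂ) (z : ℝ) {q : ℕ} (hq : 0 < q) :
    ((∑ b ∈ Icc 1 q, ‖seqSum a z q b - seqAver a z q (b.gcd q)‖ ^ 2 : ℝ) : ℂ)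
      = ∑ m ∈ Icc 1 ⌊z⌋₊, ∑ n ∈ Icc 1 ⌊z⌋₊, conj (a m) * a n * (devKernel q m n : ℂ) := by
  simp only [seqSum_sub_seqAver a z hq]
  push_cast
  simp only [← Complex.conj_mul', map_sum, map_mul, Complex.conj_ofReal, sum_mul_sum]
  rw [sum_comm]
  refine sum_congr rfl fun m _ => ?_
  rw [sum_comm]
  refine sum_congr rfl fun n _ => ?_
  rw [← sum_devKernel_mul hq m n]
  push_cast
  rw [mul_sum]
  exact sum_congr rfl fun b _ => by ring

open ComplexConjugate in
lemma norm_quadForm_sub_diag_le (I : Finset ℕ) (a : ℕ → ℂ) (κ : ℕ → ℕ → ℝ)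
    (hκ : ∀ m n, κ m n = κ n m) :
    ‖∑ m ∈ I, ∑ n ∈ I, conj (a m) * a n * (κ m n : ℂ) - ((∑ n ∈ I, ‖a n‖ ^ 2 * κ n n : ℝ) : ℂ)‖
      ≤ 2 * ‖∑ m ∈ I, ∑ n ∈ I with m < n, conj (a m) * a n * (κ m n : ℂ)‖ := by
  set O := ∑ m ∈ I, ∑ n ∈ I with m < n, conj (a m) * a n * (κ m n : ℂ) with hO
  have hconj : conj O = ∑ m ∈ I, ∑ n ∈ I with n < m, conj (a m) * a n * (κ m n : ℂ) := by
    rw [hO]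
    simp only [map_sum, sum_filter]
    rw [sum_comm]
    refine sum_congr rfl fun m _ => sum_congr rfl fun n _ => ?_
    rw [hκ n m]
    split_ifs
    · rw [map_mul, map_mul, Complex.conj_conj, Complex.conj_ofReal, mul_comm (a n)]
    · rw [map_zero]
  have hsplit : ∑ m ∈ I, ∑ n ∈ I, conj (a m) * a n * (κ m n : ℂ)
      = ((∑ n ∈ I, ‖a n‖ ^ 2 * κ n n : ℝ) : ℂ) + (O + conj O) := by
    rw [hconj, hO, ← sum_add_distrib, Complex.ofReal_sum, ← sum_add_distrib]
    refine sum_congr rfl fun m hm => ?_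
    have hdiag : ((‖a m‖ ^ 2 * κ m m : ℝ) : ℂ)
        = ∑ n ∈ I with n = m, conj (a m) * a n * (κ m n : ℂ) := by
      rw [filter_eq' I m, if_pos hm, sum_singleton, Complex.conj_mul']
      push_cast
      rfl
    rw [hdiag, sum_filter, sum_filter, sum_filter, ← sum_add_distrib, ← sum_add_distrib]
    refine sum_congr rfl fun n _ => ?_
    rcases lt_trichotomy m n with h | h | h
    · simp [h, h.ne', h.not_gt]
    · simp [h]
    · simp [h, h.ne, h.not_gt]
  rw [hsplit, add_sub_cancel_left]
  refine (norm_add_le _ _).trans (le_of_eq ?_)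
  rw [RCLike.norm_conj]
  ring

/-- The moduli `Q/2 < q ≤ Q`. -/
noncomputable def modBlock (Q : ℝ) : Finset ℕ := Ioc ⌊Q / 2⌋₊ ⌊Q⌋₊

/-- The complementary divisors `r`, for which `(n - m) / r` lies in `(Q/2, Q]`. -/
noncomputable def coBlock (x Q : ℝ) (m n : ℕ) : Finset ℕ :=
  (Icc 1 ⌊2 * x / Q⌋₊).filter fun r : ℕ =>
    r * (Q / 2) < (n : ℝ) - m ∧ (n : ℝ) - m ≤ r * Q

lemma mem_modBlock {Q : ℝ} (hQ : 0 < Q) {q : ℕ} : q ∈ modBlock Q ↔ Q / 2 < q ∧ (q : ℝ) ≤ Q := by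
  rw [modBlock, mem_Ioc, Nat.floor_lt (by positivity), Nat.le_floor_iff hQ.le]

lemma pos_of_mem_modBlock {Q : ℝ} {q : ℕ} (h : q ∈ modBlock Q) : 0 < q :=
  (Nat.zero_le _).trans_lt (mem_Ioc.1 h).1

lemma mem_coBlock {x Q : ℝ} (hQ : 0 < Q) {m n r : ℕ} (hm : 0 < m) (hn : (n : ℝ) ≤ x) (hmn : m < n) :
    r ∈ coBlock x Q m n ↔ r * (Q / 2) < (n : ℝ) - m ∧ (n : ℝ) - m ≤ r * Q := by
  rw [coBlock, mem_filter, and_iff_right_iff_imp]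
  rintro ⟨h1, h2⟩
  have hmn' : (m : ℝ) < n := by exact_mod_cast hmn
  have hm' : (0 : ℝ) < m := by exact_mod_cast hm
  rw [mem_Icc]
  constructor
  · by_contra h0
    have : r = 0 := by omega
    subst this
    norm_num at h2
    linarith
  · refine Nat.le_floor ?_
    rw [le_div_iff₀ hQ]
    linarith

lemma isDyadicBlock_modBlock {Q : ℝ} (hQ : 0 < Q) : IsDyadicBlock (modBlock Q) (Q / 2) := by
  constructor
  · intro f hf
    rw [mem_modBlock hQ] at hf
    exact ⟨hf.1.le, by linarith [hf.2]⟩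
  · intro f h1 h2
    rw [mem_modBlock hQ]
    exact ⟨h1, by linarith⟩

lemma isDyadicBlock_coBlock {x Q : ℝ} (hQ : 0 < Q) {m n : ℕ} (hm : 0 < m) (hn : (n : ℝ) ≤ x)
    (hmn : m < n) : IsDyadicBlock (coBlock x Q m n) (((n : ℝ) - m) / Q) := by
  constructor
  · intro f hf
    rw [mem_coBlock hQ hm hn hmn] at hf
    rw [div_le_iff₀ hQ, ← mul_div_assoc, le_div_iff₀ hQ]
    exact ⟨hf.2, by linarith [hf.1]⟩
  · intro f h1 h2
    rw [div_lt_iff₀ hQ] at h1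
    rw [← mul_div_assoc, lt_div_iff₀ hQ] at h2
    rw [mem_coBlock hQ hm hn hmn]
    exact ⟨by linarith, h1.le⟩

lemma mod_eq_mod_iff_dvd_sub {m n q : ℕ} (h : m ≤ n) : n % q = m % q ↔ q ∣ n - m := by
  rw [eq_comm]
  exact Nat.modEq_iff_dvd' h

lemma sum_modBlock_ite_eq_sum_coBlock {x Q : ℝ} (hQ : 0 < Q) {m n : ℕ} (hm : 0 < m)
    (hn : (n : ℝ) ≤ x) (hmn : m < n) :
    ∑ q ∈ modBlock Q, (if n % q = m % q then (1 : ℝ) else 0)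
      = ∑ r ∈ coBlock x Q m n, if n % r = m % r then (1 : ℝ) else 0 := by
  have hsub : ((n - m : ℕ) : ℝ) = (n : ℝ) - m := Nat.cast_sub hmn.le
  have hk : 0 < n - m := by omega
  have hflip : ∀ {c d : ℕ}, c * d = n - m → c ∈ modBlock Q → d ∈ coBlock x Q m n := by
    intro c d hcd hc
    rw [mem_modBlock hQ] at hc
    rw [mem_coBlock hQ hm hn hmn, ← hsub, ← hcd]
    have hd : 0 < d := Nat.pos_of_ne_zero (by rintro rfl; omega)
    have hd' : (0 : ℝ) < d := by exact_mod_cast hd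
    push_cast
    constructor <;> nlinarith [hc.1, hc.2]
  have hflip' : ∀ {c d : ℕ}, c * d = n - m → d ∈ coBlock x Q m n → c ∈ modBlock Q := by
    intro c d hcd hd
    rw [mem_coBlock hQ hm hn hmn, ← hsub, ← hcd] at hd
    rw [mem_modBlock hQ]
    have hd0 : 0 < d := Nat.pos_of_ne_zero (by rintro rfl; omega)
    have hd' : (0 : ℝ) < d := by exact_mod_cast hd0
    push_cast at hd
    constructor <;> nlinarith [hd.1, hd.2]
  simp only [mod_eq_mod_iff_dvd_sub hmn.le]
  rw [← sum_filter, ← sum_filter]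
  refine sum_nbij' (fun q => (n - m) / q) (fun r => (n - m) / r) ?_ ?_ ?_ ?_ ?_
  · intro q hq
    rw [mem_filter] at hq
    exact mem_filter.2 ⟨hflip (Nat.mul_div_cancel' hq.2) hq.1, Nat.div_dvd_of_dvd hq.2⟩
  · intro r hr
    rw [mem_filter] at hr
    exact mem_filter.2 ⟨hflip' (Nat.div_mul_cancel hr.2) hr.1, Nat.div_dvd_of_dvd hr.2⟩
  · intro q hq
    exact Nat.div_div_self (mem_filter.1 hq).2 hk.ne'
  · intro r hr
    exact Nat.div_div_self (mem_filter.1 hr).2 hk.ne'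
  · intro q _
    rfl

lemma sum_modBlock_devKernel_eq {x Q : ℝ} (hQ : 0 < Q) {m n : ℕ} (hm : 0 < m)
    (hn : (n : ℝ) ≤ x) (hmn : m < n) :
    ∑ q ∈ modBlock Q, devKernel q m n
      = ∑ r ∈ coBlock x Q m n, devKernel r m n
        + (∑ r ∈ coBlock x Q m n, gcdKernel r m n - ∑ q ∈ modBlock Q, gcdKernel q m n) := by
  simp only [devKernel, sum_sub_distrib]
  rw [sum_modBlock_ite_eq_sum_coBlock hQ hm hn hmn]
  ring

lemma gcd_mul_eq_iff {h f m : ℕ} (hh : 0 < h) :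
    m.gcd (h * f) = h ↔ h ∣ m ∧ f.Coprime (m / h) := by
  constructor
  · intro e
    have hd : h ∣ m := e ▸ Nat.gcd_dvd_left m (h * f)
    obtain ⟨k, rfl⟩ := hd
    rw [Nat.gcd_mul_left] at e
    rw [Nat.mul_div_cancel_left _ hh, Nat.coprime_comm]
    exact ⟨dvd_mul_right _ _, Nat.eq_of_mul_eq_mul_left hh (by rw [e, mul_one])⟩
  · rintro ⟨⟨k, rfl⟩, hc⟩
    rw [Nat.mul_div_cancel_left _ hh] at hc
    rw [Nat.gcd_mul_left, hc.symm.gcd_eq_one, mul_one]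

lemma sum_gcdKernel_eq {S : Finset ℕ} {D : ℕ} (hS : S ⊆ Icc 1 D) (m n : ℕ) :
    ∑ s ∈ S, gcdKernel s m n
      = ∑ h ∈ Icc 1 D with h ∣ m ∧ h ∣ n,
          ∑ f ∈ quotSet S h with f.Coprime (m / h * (n / h)), 1 / (f.totient : ℝ) := by
  have h1 : ∀ s ∈ S, gcdKernel s m n = ∑ h ∈ Icc 1 D,
      if h ∣ s then (if m.gcd s = h ∧ n.gcd s = h then 1 / ((s / h).totient : ℝ) else 0) else 0 := by
    intro s hs
    have hs' := mem_Icc.1 (hS hs)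
    rw [sum_eq_single (m.gcd s)]
    · rw [if_pos (Nat.gcd_dvd_right m s), gcdKernel]
      simp [eq_comm]
    · intro h _ hne
      split_ifs with _ h3
      · exact absurd h3.1.symm hne
      · rfl
      · rfl
    · intro hnot
      exfalso
      refine hnot (mem_Icc.2 ⟨Nat.gcd_pos_of_pos_right m hs'.1, ?_⟩)
      exact (Nat.gcd_le_right m hs'.1).trans hs'.2
  rw [sum_congr rfl h1, sum_comm, sum_filter]
  refine sum_congr rfl fun h hh => ?_
  have hh0 := (mem_Icc.1 hh).1
  rw [← sum_filter, ← sum_quotSet S hh0]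
  simp only [gcd_mul_eq_iff hh0, Nat.mul_div_cancel_left _ hh0]
  by_cases hd : h ∣ m ∧ h ∣ n
  · rw [if_pos hd, sum_filter]
    refine sum_congr rfl fun f _ => ?_
    simp only [hd.1, hd.2, true_and, Nat.coprime_mul_iff_right]
  · rw [if_neg hd]
    refine sum_eq_zero fun f _ => ?_
    rw [if_neg]
    rintro ⟨h1, h2⟩
    exact hd ⟨h1.1, h2.1⟩

lemma tau_mul_le (m n : ℕ) : tau (m * n) ≤ tau m * tau n := by
  unfold tau
  rw [Nat.divisors_mul]
  exact card_mul_le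

lemma modBlock_subset (Q : ℝ) : modBlock Q ⊆ Icc 1 ⌊Q⌋₊ := by
  intro q hq
  exact mem_Icc.2 ⟨pos_of_mem_modBlock hq, (mem_Ioc.1 hq).2⟩

lemma coBlock_subset {x Q : ℝ} (hQ : 0 < Q) (hxQ : 2 * x ≤ Q ^ 2) (m n : ℕ) :
    coBlock x Q m n ⊆ Icc 1 ⌊Q⌋₊ := by
  refine (filter_subset _ _).trans (Icc_subset_Icc_right (Nat.floor_le_floor ?_))
  rw [div_le_iff₀ hQ]
  linarith

lemma sum_quotSet_modBlock_le {Q : ℝ} (hQ : 0 < Q) {h : ℕ} (hh : 0 < h) (k : ℕ) :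
    ∑ f ∈ quotSet (modBlock Q) h with f.Coprime k, 1 / (f.totient : ℝ) ≤ 44 := by
  have hh' : (0 : ℝ) < h := by exact_mod_cast hh
  exact (sum_le_sum_of_subset_of_nonneg (filter_subset _ _) fun _ _ _ => by positivity).trans
    (((isDyadicBlock_modBlock hQ).dilate hh).sum_inv_totient_le (by positivity))

lemma sum_modBlock_gcdKernel_self_le {Q : ℝ} (hQ : 0 < Q) {n : ℕ} (hn : 0 < n) :
    ∑ q ∈ modBlock Q, gcdKernel q n n ≤ 44 * tau n := by
  rw [sum_gcdKernel_eq (modBlock_subset Q)]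
  refine (sum_le_card_nsmul _ _ 44 fun h hh => ?_).trans ?_
  · exact sum_quotSet_modBlock_le hQ (mem_Icc.1 (mem_filter.1 hh).1).1 _
  · rw [nsmul_eq_mul, mul_comm]
    gcongr
    refine card_le_card fun h hh => ?_
    rw [mem_filter] at hh
    exact Nat.mem_divisors.2 ⟨hh.2.1, hn.ne'⟩

lemma abs_sum_coBlock_sub_sum_modBlock_le {x Q : ℝ} (hQ : 0 < Q) (hxQ : 2 * x ≤ Q ^ 2)
    {m n : ℕ} (hm : 0 < m) (hn : (n : ℝ) ≤ x) (hmn : m < n) :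
    |∑ r ∈ coBlock x Q m n, gcdKernel r m n - ∑ q ∈ modBlock Q, gcdKernel q m n|
      ≤ ∑ h ∈ Icc 1 ⌊Q⌋₊ with h ∣ m ∧ h ∣ n,
          if (h : ℝ) < 2 * x / Q then
            80 * (tau (m / h) * tau (n / h) * blockError ⌊Q⌋₊ (((n : ℝ) - m) / Q / h)) else 44 := by
  rw [sum_gcdKernel_eq (modBlock_subset Q), sum_gcdKernel_eq (coBlock_subset hQ hxQ m n),
    ← sum_sub_distrib]
  refine (abs_sum_le_sum_abs _ _).trans (sum_le_sum fun h hh => ?_)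
  obtain ⟨hh1, hhm, hhn⟩ := mem_filter.1 hh
  have hh0 : 0 < h := (mem_Icc.1 hh1).1
  have hh' : (0 : ℝ) < h := by exact_mod_cast hh0
  have hmn' : (0 : ℝ) < (n : ℝ) - m := by
    have : (m : ℝ) < n := by exact_mod_cast hmn
    linarith
  have hm' : (0 : ℝ) < m := by exact_mod_cast hm
  split_ifs with hR
  · have hk : 0 < m / h * (n / h) :=
      Nat.mul_pos (Nat.div_pos (Nat.le_of_dvd hm hhm) hh0)
        (Nat.div_pos (Nat.le_of_dvd (hm.trans hmn) hhn) hh0)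
    have key := abs_sum_coprime_inv_totient_sub_le
      (quotSet_subset (coBlock_subset hQ hxQ m n) hh0) (quotSet_subset (modBlock_subset Q) hh0)
      ((isDyadicBlock_coBlock hQ hm hn hmn).dilate hh0) ((isDyadicBlock_modBlock hQ).dilate hh0)
      (by positivity) (by positivity) hk
    refine key.trans ?_
    have hmono : blockError ⌊Q⌋₊ (Q / 2 / h) ≤ blockError ⌊Q⌋₊ (((n : ℝ) - m) / Q / h) := by
      refine blockError_anti _ (by positivity) ?_
      gcongr ?_ / _
      rw [div_le_iff₀ hQ]
      nlinarith
    have htau : (tau (m / h * (n / h)) : ℝ) ≤ tau (m / h) * tau (n / h) := by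
      exact_mod_cast tau_mul_le _ _
    have hg := blockError_nonneg ⌊Q⌋₊ (Y := ((n : ℝ) - m) / Q / h) (by positivity)
    calc 40 * (tau (m / h * (n / h)) : ℝ) *
          (blockError ⌊Q⌋₊ (((n : ℝ) - m) / Q / h) + blockError ⌊Q⌋₊ (Q / 2 / h))
        ≤ 40 * (tau (m / h * (n / h)) : ℝ) * (blockError ⌊Q⌋₊ (((n : ℝ) - m) / Q / h)
            + blockError ⌊Q⌋₊ (((n : ℝ) - m) / Q / h)) := by gcongr
      _ = 80 * (tau (m / h * (n / h)) * blockError ⌊Q⌋₊ (((n : ℝ) - m) / Q / h)) := by ring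
      _ ≤ _ := by gcongr
  · have hempty : quotSet (coBlock x Q m n) h = ∅ := by
      refine eq_empty_of_forall_notMem fun f hf => hR ?_
      have hf1 := (mem_Icc.1 (quotSet_subset (coBlock_subset hQ hxQ m n) hh0 hf)).1
      rw [mem_quotSet hh0, mem_coBlock hQ hm hn hmn] at hf
      have hf1' : (1 : ℝ) ≤ f := by exact_mod_cast hf1
      have h1 := hf.1
      push_cast at h1
      rw [lt_div_iff₀ hQ]
      have : (h : ℝ) * (Q / 2) * 1 ≤ h * (Q / 2) * f := by gcongr
      linarith
    rw [hempty, filter_empty, sum_empty, zero_sub, abs_neg, abs_of_nonneg]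
    · exact sum_quotSet_modBlock_le hQ hh0 _
    · exact sum_nonneg fun _ _ => by positivity

/-- `max_{z ≤ x} |𝒜(z;r,b) − Aver(𝒜,z;r,(b,r))|`. -/
noncomputable def maxDev (a : ℕ → ℂ) (x : ℝ) (r b : ℕ) : ℝ :=
  ⨆ z ∈ Set.Icc (0 : ℝ) x, ‖seqSum a z r b - seqAver a z r (Nat.gcd b r)‖

lemma maxDev_mod (a : ℕ → ℂ) (x : ℝ) (r b : ℕ) : maxDev a x r (b % r) = maxDev a x r b := by
  simp only [maxDev, seqSum, mod_gcd, Nat.mod_mod]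

lemma norm_sum_devKernel_le_maxDev (a : ℕ → ℂ) {x z : ℝ} (hz : z ∈ Set.Icc 0 x) {r : ℕ}
    (hr : 0 < r) (b : ℕ) :
    ‖∑ n ∈ Icc 1 ⌊z⌋₊, a n * (devKernel r b n : ℂ)‖ ≤ maxDev a x r b := by
  rw [← seqSum_sub_seqAver a z hr b, maxDev]
  have hbound : ∀ w ∈ Set.Icc 0 x, ‖seqSum a w r b - seqAver a w r (Nat.gcd b r)‖
      ≤ ∑ n ∈ Icc 1 ⌊x⌋₊, ‖a n‖ := by
    intro w hw
    rw [seqSum_sub_seqAver a w hr b]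
    refine (norm_sum_le _ _).trans ?_
    refine (sum_le_sum fun n _ => ?_).trans (sum_le_sum_of_subset_of_nonneg
      (Icc_subset_Icc_right (Nat.floor_le_floor hw.2)) fun _ _ _ => norm_nonneg _)
    rw [norm_mul, Complex.norm_real, Real.norm_eq_abs]
    exact mul_le_of_le_one_right (norm_nonneg _) (abs_devKernel_le_one r b n)
  have hbdd : BddAbove (Set.range fun w : ℝ => ⨆ _ : w ∈ Set.Icc (0 : ℝ) x,
      ‖seqSum a w r b - seqAver a w r (Nat.gcd b r)‖) := by
    refine ⟨∑ n ∈ Icc 1 ⌊x⌋₊, ‖a n‖, ?_⟩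
    rintro _ ⟨w, rfl⟩
    exact Real.iSup_le (fun hw => hbound w hw) (sum_nonneg fun _ _ => norm_nonneg _)
  refine le_ciSup_of_le hbdd z ?_
  rw [ciSup_pos hz]

lemma progLHS_eq (a : ℕ → ℂ) (x Q : ℝ) :
    progLHS a x Q = ∑ m ∈ Icc 1 ⌊x⌋₊, ‖a m‖ * ∑ r ∈ Icc 1 ⌊2 * x / Q⌋₊, maxDev a x r m := by
  simp only [mul_sum]
  rw [sum_comm, progLHS]
  refine sum_congr rfl fun r hr => ?_
  have h1 : ∀ b ∈ Icc 1 r, (∑ n ∈ (Icc 1 ⌊x⌋₊).filter (fun n => n % r = b % r), ‖a n‖) *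
      (⨆ z ∈ Set.Icc (0 : ℝ) x, ‖seqSum a z r b - seqAver a z r (Nat.gcd b r)‖)
      = ∑ n ∈ Icc 1 ⌊x⌋₊, if n % r = b % r then ‖a n‖ * maxDev a x r b else 0 := by
    intro b _
    rw [sum_mul, sum_filter]
    rfl
  rw [sum_congr rfl h1, sum_comm]
  refine sum_congr rfl fun n _ => ?_
  exact sum_Icc_ite_mod (fun b => ‖a n‖ * maxDev a x r b) (mem_Icc.1 hr).1
    (fun b => by rw [maxDev_mod]) n

lemma norm_sum_interval_devKernel_le (a : ℕ → ℂ) {x u v : ℝ} (hx : 0 ≤ x) (hu : 0 ≤ u) (huv : u ≤ v)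
    {r : ℕ} (hr : 0 < r) (b : ℕ) :
    ‖∑ n ∈ Icc 1 ⌊x⌋₊ with (u < (n : ℕ) ∧ ((n : ℕ) : ℝ) ≤ v), a n * (devKernel r b n : ℂ)‖
      ≤ 2 * maxDev a x r b := by
  have hv := hu.trans huv
  have hsub : Icc 1 ⌊min x u⌋₊ ⊆ Icc 1 ⌊min x v⌋₊ :=
    Icc_subset_Icc_right (Nat.floor_le_floor (min_le_min le_rfl huv))
  have heq : (Icc 1 ⌊x⌋₊).filter (fun n : ℕ => u < (n : ℝ) ∧ (n : ℝ) ≤ v)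
      = Icc 1 ⌊min x v⌋₊ \ Icc 1 ⌊min x u⌋₊ := by
    ext n
    simp only [mem_filter, mem_sdiff, mem_Icc, Nat.le_floor_iff hx,
      Nat.le_floor_iff (le_min hx hu), Nat.le_floor_iff (le_min hx hv), le_min_iff, ← not_le]
    tauto
  rw [heq, sum_sdiff_eq_sub hsub]
  refine (norm_sub_le _ _).trans ?_
  have h1 := norm_sum_devKernel_le_maxDev a (x := x) (z := min x v)
    ⟨le_min hx hv, min_le_left _ _⟩ hr b
  have h2 := norm_sum_devKernel_le_maxDev a (x := x) (z := min x u)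
    ⟨le_min hx hu, min_le_left _ _⟩ hr b
  linarith

open ComplexConjugate in
lemma norm_sum_coBlock_devKernel_le (a : ℕ → ℂ) {x Q : ℝ} (hx : 0 ≤ x) (hQ : 0 < Q) :
    ‖∑ m ∈ Icc 1 ⌊x⌋₊, ∑ n ∈ Icc 1 ⌊x⌋₊ with m < n,
        conj (a m) * a n * ((∑ r ∈ coBlock x Q m n, devKernel r m n : ℝ) : ℂ)‖
      ≤ 2 * progLHS a x Q := by
  rw [progLHS_eq, mul_sum]
  refine (norm_sum_le _ _).trans (sum_le_sum fun m _ => ?_)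
  have h1 : ∑ n ∈ Icc 1 ⌊x⌋₊ with m < n,
        conj (a m) * a n * ((∑ r ∈ coBlock x Q m n, devKernel r m n : ℝ) : ℂ)
      = conj (a m) * ∑ r ∈ Icc 1 ⌊2 * x / Q⌋₊,
          ∑ n ∈ Icc 1 ⌊x⌋₊ with ((m : ℝ) + r * (Q / 2) < (n : ℕ) ∧ ((n : ℕ) : ℝ) ≤ m + r * Q),
            a n * (devKernel r m n : ℂ) := by
    rw [mul_sum, sum_filter]
    simp only [coBlock, sum_filter, Complex.ofReal_sum, mul_sum]
    rw [sum_comm]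
    refine sum_congr rfl fun n _ => ?_
    by_cases hmn : m < n
    · rw [if_pos hmn]
      refine sum_congr rfl fun r _ => ?_
      have hiff : (r * (Q / 2) < (n : ℝ) - m ∧ (n : ℝ) - m ≤ r * Q)
          ↔ ((m : ℝ) + r * (Q / 2) < n ∧ (n : ℝ) ≤ m + r * Q) := by
        constructor <;> rintro ⟨h1, h2⟩ <;> constructor <;> linarith
      simp only [hiff]
      split_ifs
      · ring
      · simp
    · rw [if_neg hmn]
      symm
      refine sum_eq_zero fun r _ => ?_
      rw [if_neg, mul_zero]
      rintro ⟨h1, -⟩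
      apply hmn
      have : (0 : ℝ) ≤ r * (Q / 2) := by positivity
      have : (m : ℝ) < n := by linarith
      exact_mod_cast this
  rw [h1, norm_mul, RCLike.norm_conj, mul_left_comm]
  gcongr
  rw [mul_sum]
  refine (norm_sum_le _ _).trans (sum_le_sum fun r hr => ?_)
  refine norm_sum_interval_devKernel_le a hx (by positivity) ?_ (mem_Icc.1 hr).1 m
  gcongr
  linarith

lemma sum_divisors_tau_le_tau3 {m : ℕ} (hm : 0 < m) : ∑ h ∈ m.divisors, tau (m / h) ≤ tau3 m := by
  have hfin : {t : ℕ × ℕ × ℕ | t.1 * t.2.1 * t.2.2 = m}.Finite := by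
    refine (((Icc 1 m) ×ˢ ((Icc 1 m) ×ˢ (Icc 1 m))).finite_toSet).subset ?_
    rintro ⟨u, v, w⟩ ht
    simp only [Set.mem_ofPred_eq] at ht
    have hu : 0 < u := Nat.pos_of_ne_zero (by rintro rfl; simp at ht; omega)
    have hv : 0 < v := Nat.pos_of_ne_zero (by rintro rfl; simp at ht; omega)
    have hw : 0 < w := Nat.pos_of_ne_zero (by rintro rfl; simp at ht; omega)
    have hu' : u ≤ m := Nat.le_of_dvd hm ⟨v * w, by rw [← ht, mul_assoc]⟩
    have hv' : v ≤ m := Nat.le_of_dvd hm ⟨u * w, by rw [← ht]; ring⟩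
    have hw' : w ≤ m := Nat.le_of_dvd hm ⟨u * v, by rw [← ht]; ring⟩
    simp only [coe_product, Set.mem_prod, coe_Icc, Set.mem_Icc]
    omega
  have h1 : tau3 m = hfin.toFinset.card := by
    rw [tau3, ← Set.ncard_eq_toFinset_card _ hfin]
    exact Nat.card_coe_set_eq _
  simp only [tau]
  rw [h1, ← card_sigma]
  refine card_le_card_of_injOn (fun p => (p.1, p.2, m / p.1 / p.2)) ?_ ?_
  · rintro ⟨h, d⟩ hp
    rw [mem_coe, mem_sigma, Nat.mem_divisors, Nat.mem_divisors] at hp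
    simp only [mem_coe, Set.Finite.mem_toFinset, Set.mem_ofPred_eq]
    rw [mul_assoc, Nat.mul_div_cancel' hp.2.1, Nat.mul_div_cancel' hp.1.1]
  · rintro ⟨h, d⟩ _ ⟨h', d'⟩ _ heq
    simp only [Prod.mk.injEq] at heq
    obtain ⟨rfl, rfl, -⟩ := heq
    rfl

lemma exists_half_interval {x Q d : ℝ} (hQ : 0 < Q) (hd : 0 < d) (hdx : d ≤ x) :
    ∃ j ∈ range (⌊2 * x / Q⌋₊ + 1), (j : ℝ) * (Q / 2) < d ∧ d ≤ j * (Q / 2) + Q / 2 := by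
  have hpos : 0 < ⌈d / (Q / 2)⌉₊ := Nat.ceil_pos.2 (by positivity)
  have h1 : d / (Q / 2) ≤ ⌈d / (Q / 2)⌉₊ := Nat.le_ceil _
  have h2 : (⌈d / (Q / 2)⌉₊ : ℝ) < d / (Q / 2) + 1 := Nat.ceil_lt_add_one (by positivity)
  obtain ⟨j, hj⟩ : ∃ j, ⌈d / (Q / 2)⌉₊ = j + 1 := ⟨⌈d / (Q / 2)⌉₊ - 1, by omega⟩
  rw [hj] at h1 h2
  push_cast at h1 h2
  have h3 : (j : ℝ) < d / (Q / 2) := by linarith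
  rw [div_le_iff₀ (by positivity)] at h1
  have h3' := h3
  rw [lt_div_iff₀ (by positivity)] at h3'
  refine ⟨j, mem_range.2 (Nat.lt_succ_of_le (Nat.le_floor ?_)), h3', by linarith⟩
  rw [le_div_iff₀ hQ]
  linarith

lemma sum_tau_mul_blockError_le {a : ℕ → ℂ} {x Q E : ℝ} (hQ : 0 < Q) (hQx : Q ≤ x) (D : ℕ) {h : ℕ}
    (hh : 0 < h)
    (hE : ∀ y : ℝ, ∑ n ∈ (Icc 1 ⌊x⌋₊).filter
      (fun n : ℕ => y < (n : ℝ) ∧ (n : ℝ) ≤ y + Q / 2), ‖a (n * h)‖ * (tau n : ℝ) ≤ E) (m : ℕ) :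
    ∑ n ∈ quotSet (Icc 1 ⌊x⌋₊) h with m < n,
        ‖a (h * n)‖ * tau n * blockError D (((n : ℝ) - m) / Q)
      ≤ E * (50 * Real.log (2 * x / Q) ^ 2) := by
  have hx : 0 < x := hQ.trans_le hQx
  have hE0 : 0 ≤ E := (sum_nonneg fun _ _ => by positivity).trans (hE 0)
  calc ∑ n ∈ quotSet (Icc 1 ⌊x⌋₊) h with m < n,
        ‖a (h * n)‖ * tau n * blockError D (((n : ℝ) - m) / Q)
      ≤ ∑ n ∈ quotSet (Icc 1 ⌊x⌋₊) h with m < n, ∑ j ∈ range (⌊2 * x / Q⌋₊ + 1),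
          if (m : ℝ) + j * (Q / 2) < n ∧ (n : ℝ) ≤ m + j * (Q / 2) + Q / 2 then
            ‖a (n * h)‖ * tau n * blockError D ((j : ℝ) / 2) else 0 := by
        refine sum_le_sum fun n hn => ?_
        rw [mem_filter] at hn
        have hnI := mem_Icc.1 (quotSet_subset Subset.rfl hh hn.1)
        have hnx : (n : ℝ) ≤ x := (Nat.le_floor_iff hx.le).1 hnI.2
        have hmn : (m : ℝ) < n := by exact_mod_cast hn.2
        have hm0 : (0 : ℝ) ≤ m := by positivity
        obtain ⟨j, hj, hj1, hj2⟩ := exists_half_interval (x := x) (d := (n : ℝ) - m) hQ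
          (by linarith) (by linarith)
        refine le_trans ?_ (single_le_sum (fun i _ => ?_) hj)
        · rw [if_pos ⟨by linarith, by linarith⟩, mul_comm n h]
          gcongr
          refine blockError_anti D (by positivity) ?_
          rw [le_div_iff₀ hQ]
          linarith
        · have := blockError_nonneg D (Y := (i : ℝ) / 2) (by positivity)
          split_ifs <;> positivity
    _ ≤ ∑ n ∈ Icc 1 ⌊x⌋₊, ∑ j ∈ range (⌊2 * x / Q⌋₊ + 1),
          if (m : ℝ) + j * (Q / 2) < n ∧ (n : ℝ) ≤ m + j * (Q / 2) + Q / 2 then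
            ‖a (n * h)‖ * tau n * blockError D ((j : ℝ) / 2) else 0 := by
        refine sum_le_sum_of_subset_of_nonneg
          ((filter_subset _ _).trans (quotSet_subset Subset.rfl hh)) fun n _ _ =>
            sum_nonneg fun j _ => ?_
        have := blockError_nonneg D (Y := (j : ℝ) / 2) (by positivity)
        split_ifs <;> positivity
    _ = ∑ j ∈ range (⌊2 * x / Q⌋₊ + 1), (∑ n ∈ (Icc 1 ⌊x⌋₊).filter
          (fun n : ℕ => (m : ℝ) + j * (Q / 2) < (n : ℝ) ∧ (n : ℝ) ≤ m + j * (Q / 2) + Q / 2),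
            ‖a (n * h)‖ * (tau n : ℝ)) * blockError D ((j : ℝ) / 2) := by
        rw [sum_comm]
        refine sum_congr rfl fun j _ => ?_
        rw [sum_mul, sum_filter]
    _ ≤ ∑ j ∈ range (⌊2 * x / Q⌋₊ + 1), E * blockError D ((j : ℝ) / 2) := by
        refine sum_le_sum fun j _ => ?_
        exact mul_le_mul_of_nonneg_right (hE _) (blockError_nonneg D (by positivity))
    _ ≤ E * (50 * Real.log (2 * x / Q) ^ 2) := by
        rw [← mul_sum]
        refine mul_le_mul_of_nonneg_left (sum_range_blockError_le_log_sq D ?_) hE0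
        rw [le_div_iff₀ hQ]
        linarith

lemma sum_dvd_tau_mul_blockError_le {a : ℕ → ℂ} {x Q E : ℝ} (hQ : 0 < Q) (hQx : Q ≤ x) (D : ℕ)
    {h : ℕ} (hh : 0 < h)
    (hE : ∀ y : ℝ, ∑ n ∈ (Icc 1 ⌊x⌋₊).filter
      (fun n : ℕ => y < (n : ℝ) ∧ (n : ℝ) ≤ y + Q / 2), ‖a (n * h)‖ * (tau n : ℝ) ≤ E)
    {m : ℕ} (hm : h ∣ m) :
    ∑ n ∈ Icc 1 ⌊x⌋₊ with h ∣ n, (if m < n then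
        ‖a n‖ * tau (n / h) * blockError D (((n : ℝ) - m) / Q / h) else 0)
      ≤ E * (50 * Real.log (2 * x / Q) ^ 2) := by
  obtain ⟨k, rfl⟩ := hm
  rw [← sum_quotSet _ hh]
  refine le_trans (le_of_eq ?_) (sum_tau_mul_blockError_le hQ hQx D hh hE k)
  rw [sum_filter]
  refine sum_congr rfl fun n _ => ?_
  have hh' : (h : ℝ) ≠ 0 := by exact_mod_cast hh.ne'
  have harg : (((h * n : ℕ) : ℝ) - (h * k : ℕ)) / Q / h = ((n : ℝ) - k) / Q := by
    push_cast
    field_simp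
  rw [harg, Nat.mul_div_cancel_left _ hh]
  simp only [mul_lt_mul_iff_right₀ hh]

lemma sum_sum_dvd_tau_le (a : ℕ → ℂ) (x : ℝ) (T : Finset ℕ) :
    ∑ h ∈ T, ∑ m ∈ Icc 1 ⌊x⌋₊ with h ∣ m, ‖a m‖ * (tau (m / h) : ℝ)
      ≤ ∑ m ∈ Icc 1 ⌊x⌋₊, ‖a m‖ * (tau3 m : ℝ) := by
  simp only [sum_filter]
  rw [sum_comm]
  refine sum_le_sum fun m hm => ?_
  have hm0 : 0 < m := (mem_Icc.1 hm).1
  rw [← sum_filter, ← mul_sum]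
  gcongr
  refine le_trans ?_ (Nat.cast_le.2 (sum_divisors_tau_le_tau3 hm0))
  push_cast
  refine sum_le_sum_of_subset_of_nonneg (fun h hh => ?_) fun _ _ _ => by positivity
  exact Nat.mem_divisors.2 ⟨(mem_filter.1 hh).2, hm0.ne'⟩

/-- The majorant of the off-diagonal contribution of a pair `m < n` with common divisor `h`. -/
noncomputable def pairBound (x Q : ℝ) (h m n : ℕ) : ℝ :=
  if (h : ℝ) < 2 * x / Q then
    80 * (tau (m / h) * tau (n / h) * blockError ⌊Q⌋₊ (((n : ℝ) - m) / Q / h)) else 44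

lemma sum_sum_pairBound_le_of_lt {a : ℕ → ℂ} {x Q E : ℝ} (hQ : 0 < Q) (hQx : Q ≤ x)
    {h : ℕ} (hh : 0 < h) (hhx : (h : ℝ) < 2 * x / Q)
    (hE : ∀ y : ℝ, ∑ n ∈ (Icc 1 ⌊x⌋₊).filter
      (fun n : ℕ => y < (n : ℝ) ∧ (n : ℝ) ≤ y + Q / 2), ‖a (n * h)‖ * (tau n : ℝ) ≤ E) :
    ∑ m ∈ Icc 1 ⌊x⌋₊ with h ∣ m, ∑ n ∈ Icc 1 ⌊x⌋₊ with h ∣ n,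
        (if m < n then ‖a m‖ * ‖a n‖ * pairBound x Q h m n else 0)
      ≤ (∑ m ∈ Icc 1 ⌊x⌋₊ with h ∣ m, ‖a m‖ * (tau (m / h) : ℝ))
          * (4000 * (E * Real.log (2 * x / Q) ^ 2)) := by
  rw [sum_mul]
  refine sum_le_sum fun m hm => ?_
  have h1 := sum_dvd_tau_mul_blockError_le hQ hQx ⌊Q⌋₊ hh hE (mem_filter.1 hm).2
  calc ∑ n ∈ Icc 1 ⌊x⌋₊ with h ∣ n,
        (if m < n then ‖a m‖ * ‖a n‖ * pairBound x Q h m n else 0)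
      = ‖a m‖ * tau (m / h) * 80 * ∑ n ∈ Icc 1 ⌊x⌋₊ with h ∣ n, (if m < n then
          ‖a n‖ * tau (n / h) * blockError ⌊Q⌋₊ (((n : ℝ) - m) / Q / h) else 0) := by
        rw [mul_sum]
        refine sum_congr rfl fun n _ => ?_
        rw [pairBound, if_pos hhx]
        split_ifs
        · ring
        · simp
    _ ≤ ‖a m‖ * tau (m / h) * 80 * (E * (50 * Real.log (2 * x / Q) ^ 2)) := by gcongr
    _ = ‖a m‖ * tau (m / h) * (4000 * (E * Real.log (2 * x / Q) ^ 2)) := by ring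

lemma sum_sum_pairBound_le_of_le (a : ℕ → ℂ) {x Q : ℝ} {h : ℕ} (hhx : 2 * x / Q ≤ (h : ℝ)) :
    ∑ m ∈ Icc 1 ⌊x⌋₊ with h ∣ m, ∑ n ∈ Icc 1 ⌊x⌋₊ with h ∣ n,
        (if m < n then ‖a m‖ * ‖a n‖ * pairBound x Q h m n else 0)
      ≤ 44 * (∑ n ∈ Icc 1 ⌊x⌋₊ with h ∣ n, ‖a n‖) ^ 2 := by
  rw [sq, sum_mul_sum, mul_sum]
  refine sum_le_sum fun m _ => ?_
  rw [mul_sum]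
  refine sum_le_sum fun n _ => ?_
  rw [pairBound, if_neg hhx.not_gt]
  split_ifs
  · exact (mul_comm _ _).le
  · positivity

open ComplexConjugate in
lemma norm_sum_gcdKernel_le {a : ℕ → ℂ} {x Q E : ℝ} (hQ : 0 < Q) (hQx : Q ≤ x)
    (hxQ : 2 * x ≤ Q ^ 2) (hE0 : 0 ≤ E)
    (hE : ∀ h : ℕ, 1 ≤ h → (h : ℝ) ≤ 2 * x / Q → ∀ y : ℝ, ∑ n ∈ (Icc 1 ⌊x⌋₊).filter
      (fun n : ℕ => y < (n : ℝ) ∧ (n : ℝ) ≤ y + Q / 2), ‖a (n * h)‖ * (tau n : ℝ) ≤ E) :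
    ‖∑ m ∈ Icc 1 ⌊x⌋₊, ∑ n ∈ Icc 1 ⌊x⌋₊ with m < n, conj (a m) * a n *
        ((∑ r ∈ coBlock x Q m n, gcdKernel r m n - ∑ q ∈ modBlock Q, gcdKernel q m n : ℝ) : ℂ)‖
      ≤ 4000 * ((∑ m ∈ Icc 1 ⌊x⌋₊, ‖a m‖ * (tau3 m : ℝ)) * E * Real.log (2 * x / Q) ^ 2)
        + 44 * concLHS a x Q (2 * x / Q) := by
  have hx : 0 < x := hQ.trans_le hQx
  calc ‖∑ m ∈ Icc 1 ⌊x⌋₊, ∑ n ∈ Icc 1 ⌊x⌋₊ with m < n, conj (a m) * a n *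
        ((∑ r ∈ coBlock x Q m n, gcdKernel r m n - ∑ q ∈ modBlock Q, gcdKernel q m n : ℝ) : ℂ)‖
      ≤ ∑ m ∈ Icc 1 ⌊x⌋₊, ∑ n ∈ Icc 1 ⌊x⌋₊ with m < n, ‖a m‖ * ‖a n‖ *
          ∑ h ∈ Icc 1 ⌊Q⌋₊ with h ∣ m ∧ h ∣ n, pairBound x Q h m n := by
        refine (norm_sum_le _ _).trans (sum_le_sum fun m hm => ?_)
        refine (norm_sum_le _ _).trans (sum_le_sum fun n hn => ?_)
        rw [mem_filter, mem_Icc] at hn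
        rw [norm_mul, norm_mul, RCLike.norm_conj, Complex.norm_real, Real.norm_eq_abs]
        gcongr
        exact abs_sum_coBlock_sub_sum_modBlock_le hQ hxQ (mem_Icc.1 hm).1
          ((Nat.le_floor_iff hx.le).1 hn.1.2) hn.2
    _ = ∑ h ∈ Icc 1 ⌊Q⌋₊, ∑ m ∈ Icc 1 ⌊x⌋₊ with h ∣ m, ∑ n ∈ Icc 1 ⌊x⌋₊ with h ∣ n,
          (if m < n then ‖a m‖ * ‖a n‖ * pairBound x Q h m n else 0) := by
        simp only [sum_filter, mul_sum]
        symm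
        rw [sum_comm]
        refine sum_congr rfl fun m _ => ?_
        have : ∀ h, (if h ∣ m then ∑ n ∈ Icc 1 ⌊x⌋₊, (if h ∣ n then
            (if m < n then ‖a m‖ * ‖a n‖ * pairBound x Q h m n else 0) else 0) else 0)
            = ∑ n ∈ Icc 1 ⌊x⌋₊, if m < n then
                ‖a m‖ * ‖a n‖ * (if h ∣ m ∧ h ∣ n then pairBound x Q h m n else 0) else 0 := by
          intro h
          by_cases hm : h ∣ m
          · simp only [hm, if_true, true_and]
            refine sum_congr rfl fun n _ => ?_
            split_ifs <;> simp
          · simp [hm]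
        simp only [this]
        rw [sum_comm]
        refine sum_congr rfl fun n _ => ?_
        split_ifs <;> simp
    _ ≤ ∑ h ∈ Icc 1 ⌊Q⌋₊, ((∑ m ∈ Icc 1 ⌊x⌋₊ with h ∣ m, ‖a m‖ * (tau (m / h) : ℝ))
            * (4000 * (E * Real.log (2 * x / Q) ^ 2))
          + if 2 * x / Q ≤ (h : ℝ) then
              44 * (∑ n ∈ Icc 1 ⌊x⌋₊ with h ∣ n, ‖a n‖) ^ 2 else 0) := by
        refine sum_le_sum fun h hh => ?_
        have hh0 := (mem_Icc.1 hh).1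
        split_ifs with hhx
        · refine (sum_sum_pairBound_le_of_le a hhx).trans (le_add_of_nonneg_left ?_)
          exact mul_nonneg (sum_nonneg fun _ _ => by positivity) (by positivity)
        · rw [not_le] at hhx
          rw [add_zero]
          exact sum_sum_pairBound_le_of_lt hQ hQx hh0 hhx (hE h hh0 hhx.le)
    _ ≤ _ := by
        rw [sum_add_distrib, ← sum_mul, ← sum_filter, ← mul_sum, concLHS]
        refine add_le_add_left ?_ _
        refine (mul_le_mul_of_nonneg_right (sum_sum_dvd_tau_le a x _) (by positivity)).trans ?_
        exact le_of_eq (by ring)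

lemma abs_card_modBlock_sub_le {Q : ℝ} (hQ : 0 < Q) : |((modBlock Q).card : ℝ) - Q / 2| ≤ 1 := by
  have hle : ⌊Q / 2⌋₊ ≤ ⌊Q⌋₊ := Nat.floor_le_floor (by linarith)
  rw [modBlock, Nat.card_Ioc, Nat.cast_sub hle, abs_le]
  have h1 := Nat.floor_le hQ.le
  have h2 := Nat.lt_floor_add_one Q
  have h3 := Nat.floor_le (half_pos hQ).le
  have h4 := Nat.lt_floor_add_one (Q / 2)
  constructor <;> linarith

lemma abs_sum_diag_sub_le (a : ℕ → ℂ) (x : ℝ) {Q : ℝ} (hQ : 0 < Q) :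
    |∑ n ∈ Icc 1 ⌊x⌋₊, ‖a n‖ ^ 2 * ∑ q ∈ modBlock Q, devKernel q n n
        - Q / 2 * ∑ n ∈ Icc 1 ⌊x⌋₊, ‖a n‖ ^ 2|
      ≤ 45 * ∑ n ∈ Icc 1 ⌊x⌋₊, ‖a n‖ ^ 2 * (tau n : ℝ) := by
  rw [mul_sum, mul_sum, ← sum_sub_distrib]
  refine (abs_sum_le_sum_abs _ _).trans (sum_le_sum fun n hn => ?_)
  have hn0 : 0 < n := (mem_Icc.1 hn).1
  have htau : (1 : ℝ) ≤ tau n := by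
    exact_mod_cast card_pos.2 ⟨1, Nat.one_mem_divisors.2 hn0.ne'⟩
  have hsum : ∑ q ∈ modBlock Q, devKernel q n n
      = (modBlock Q).card - ∑ q ∈ modBlock Q, gcdKernel q n n := by
    simp [devKernel, sum_sub_distrib]
  have hg := sum_modBlock_gcdKernel_self_le hQ hn0
  have hg0 : 0 ≤ ∑ q ∈ modBlock Q, gcdKernel q n n :=
    sum_nonneg fun q _ => gcdKernel_nonneg q n n
  have hc := abs_le.1 (abs_card_modBlock_sub_le hQ)
  have hbound : |∑ q ∈ modBlock Q, devKernel q n n - Q / 2| ≤ 45 * tau n := by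
    rw [hsum, abs_le]
    constructor <;> linarith [hc.1, hc.2]
  calc |‖a n‖ ^ 2 * ∑ q ∈ modBlock Q, devKernel q n n - Q / 2 * ‖a n‖ ^ 2|
      = ‖a n‖ ^ 2 * |∑ q ∈ modBlock Q, devKernel q n n - Q / 2| := by
        rw [mul_comm (Q / 2), ← mul_sub, abs_mul, abs_of_nonneg (sq_nonneg _)]
    _ ≤ ‖a n‖ ^ 2 * (45 * tau n) := by gcongr
    _ = 45 * (‖a n‖ ^ 2 * tau n) := by ring

open ComplexConjugate in
lemma varV_eq_quadForm (a : ℕ → ℂ) (x Q : ℝ) :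
    (varV a x Q : ℂ) = ∑ m ∈ Icc 1 ⌊x⌋₊, ∑ n ∈ Icc 1 ⌊x⌋₊,
      conj (a m) * a n * ((∑ q ∈ modBlock Q, devKernel q m n : ℝ) : ℂ) := by
  rw [varV, ← modBlock, Complex.ofReal_sum]
  rw [sum_congr rfl fun q hq =>
    sum_norm_seqSum_sub_seqAver_sq a x (pos_of_mem_modBlock hq), sum_comm]
  refine sum_congr rfl fun m _ => ?_
  rw [sum_comm]
  refine sum_congr rfl fun n _ => ?_
  rw [Complex.ofReal_sum, mul_sum]

open ComplexConjugate in
lemma abs_varV_sub_le {a : ℕ → ℂ} {x Q E : ℝ} (hQ : 0 < Q) (hQx : Q ≤ x)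
    (hxQ : 2 * x ≤ Q ^ 2) (hE0 : 0 ≤ E)
    (hE : ∀ h : ℕ, 1 ≤ h → (h : ℝ) ≤ 2 * x / Q → ∀ y : ℝ, ∑ n ∈ (Icc 1 ⌊x⌋₊).filter
      (fun n : ℕ => y < (n : ℝ) ∧ (n : ℝ) ≤ y + Q / 2), ‖a (n * h)‖ * (tau n : ℝ) ≤ E) :
    |varV a x Q - Q / 2 * ∑ n ∈ Icc 1 ⌊x⌋₊, ‖a n‖ ^ 2|
      ≤ 4 * progLHS a x Q + 88 * concLHS a x Q (2 * x / Q)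
        + 8000 * ((∑ m ∈ Icc 1 ⌊x⌋₊, ‖a m‖ * (tau3 m : ℝ)) * E * Real.log (2 * x / Q) ^ 2)
        + 45 * ∑ n ∈ Icc 1 ⌊x⌋₊, ‖a n‖ ^ 2 * (tau n : ℝ) := by
  have hx : 0 < x := hQ.trans_le hQx
  have hdiag := abs_sum_diag_sub_le a x hQ
  have hquad := norm_quadForm_sub_diag_le (Icc 1 ⌊x⌋₊) a
    (fun m n => ∑ q ∈ modBlock Q, devKernel q m n)
    (fun m n => sum_congr rfl fun q _ => devKernel_comm q m n)
  rw [← varV_eq_quadForm a x Q, ← Complex.ofReal_sub, Complex.norm_real, Real.norm_eq_abs] at hquad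
  have hoff : ∑ m ∈ Icc 1 ⌊x⌋₊, ∑ n ∈ Icc 1 ⌊x⌋₊ with m < n,
        conj (a m) * a n * ((∑ q ∈ modBlock Q, devKernel q m n : ℝ) : ℂ)
      = ∑ m ∈ Icc 1 ⌊x⌋₊, ∑ n ∈ Icc 1 ⌊x⌋₊ with m < n,
          conj (a m) * a n * ((∑ r ∈ coBlock x Q m n, devKernel r m n : ℝ) : ℂ)
        + ∑ m ∈ Icc 1 ⌊x⌋₊, ∑ n ∈ Icc 1 ⌊x⌋₊ with m < n, conj (a m) * a n *
          ((∑ r ∈ coBlock x Q m n, gcdKernel r m n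
            - ∑ q ∈ modBlock Q, gcdKernel q m n : ℝ) : ℂ) := by
    rw [← sum_add_distrib]
    refine sum_congr rfl fun m hm => ?_
    rw [← sum_add_distrib]
    refine sum_congr rfl fun n hn => ?_
    rw [mem_filter, mem_Icc] at hn
    rw [sum_modBlock_devKernel_eq hQ (mem_Icc.1 hm).1 ((Nat.le_floor_iff hx.le).1 hn.1.2) hn.2,
      Complex.ofReal_add, mul_add]
  rw [hoff] at hquad
  have hadd := norm_add_le (∑ m ∈ Icc 1 ⌊x⌋₊, ∑ n ∈ Icc 1 ⌊x⌋₊ with m < n,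
      conj (a m) * a n * ((∑ r ∈ coBlock x Q m n, devKernel r m n : ℝ) : ℂ))
    (∑ m ∈ Icc 1 ⌊x⌋₊, ∑ n ∈ Icc 1 ⌊x⌋₊ with m < n, conj (a m) * a n *
      ((∑ r ∈ coBlock x Q m n, gcdKernel r m n - ∑ q ∈ modBlock Q, gcdKernel q m n : ℝ) : ℂ))
  have hprog := norm_sum_coBlock_devKernel_le a hx.le hQ
  have hgcd := norm_sum_gcdKernel_le hQ hQx hxQ hE0 hE
  refine (abs_sub_le _ _ _).trans ((add_le_add hquad hdiag).trans ?_)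
  linarith

/-- Theorem 1 of the paper. Suppose `√(2x) < Q ≤ x` are large and the complex sequence
`(a_n)_{n ≤ x}` satisfies the Progressions Condition (parameter `K_prog`), the
Non-concentration on Multiples condition (parameters `K_conc[H]`), and the Hereditarily
Sparse condition (parameter `K_hered`): for every `h ≤ 2x/Q` and every interval `I` of
length `Q/2`, `Σ_{n ∈ I} |a_{nh}| τ(n) ≤ (1/K_hered)(Σ_{n ≤ x}|a_n|)²/(Σ_{n ≤ x}|a_n|τ₃(n))`.
Then `V(𝒜,x,Q) = (Q/2) Σ_{n ≤ x} |a_n|²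
  + O((Σ_{n ≤ x}|a_n|)²(1/K_prog + 1/K_conc[2x/Q] + log²(2x/Q)/K_hered)
      + Σ_{n ≤ x}|a_n|²τ(n))`, with an absolute implied constant. -/
theorem statement_0 :
    ∃ C : ℝ, 0 < C ∧ ∀ (x Q Kprog Khered : ℝ) (Kconc : ℝ → ℝ) (a : ℕ → ℂ),
      C ≤ x → Real.sqrt (2 * x) < Q → Q ≤ x →
      (∀ n : ℕ, x < n → a n = 0) →
      -- Progressions Condition
      0 < Kprog →
      progLHS a x Q ≤ (∑ n ∈ Finset.Icc 1 ⌊x⌋₊, ‖a n‖) ^ 2 / Kprog →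
      -- Non-concentration on Multiples condition
      (∀ H : ℝ, H ≤ Q → 0 < Kconc H ∧
        concLHS a x Q H ≤ (∑ n ∈ Finset.Icc 1 ⌊x⌋₊, ‖a n‖) ^ 2 / Kconc H) →
      -- Hereditarily Sparse condition
      0 < Khered →
      (∀ h : ℕ, 1 ≤ h → (h : ℝ) ≤ 2 * x / Q → ∀ y : ℝ,
        ∑ n ∈ (Finset.Icc 1 ⌊x⌋₊).filter (fun n : ℕ => y < (n : ℝ) ∧ (n : ℝ) ≤ y + Q / 2),
            ‖a (n * h)‖ * (tau n : ℝ)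
          ≤ (1 / Khered) * (∑ n ∈ Finset.Icc 1 ⌊x⌋₊, ‖a n‖) ^ 2 /
              (∑ n ∈ Finset.Icc 1 ⌊x⌋₊, ‖a n‖ * (tau3 n : ℝ))) →
      |varV a x Q - Q / 2 * ∑ n ∈ Finset.Icc 1 ⌊x⌋₊, ‖a n‖ ^ 2|
        ≤ C * ((∑ n ∈ Finset.Icc 1 ⌊x⌋₊, ‖a n‖) ^ 2 *
              (1 / Kprog + 1 / Kconc (2 * x / Q) + (Real.log (2 * x / Q)) ^ 2 / Khered)
            + ∑ n ∈ Finset.Icc 1 ⌊x⌋₊, ‖a n‖ ^ 2 * (tau n : ℝ)) := by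
  refine ⟨10000, by norm_num, ?_⟩
  intro x Q Kprog Khered Kconc a hCx hsq hQx _ hKp hprog hconc hKh hhered
  have hx : 0 < x := by linarith
  have hQ : 0 < Q := (Real.sqrt_nonneg _).trans_lt hsq
  have hxQ : 2 * x ≤ Q ^ 2 := ((Real.sqrt_lt' hQ).1 hsq).le
  have hRQ : 2 * x / Q ≤ Q := by
    rw [div_le_iff₀ hQ, ← sq]
    exact hxQ
  obtain ⟨hKc, hconcR⟩ := hconc (2 * x / Q) hRQ
  set S := ∑ n ∈ Finset.Icc 1 ⌊x⌋₊, ‖a n‖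
  set S3 := ∑ n ∈ Finset.Icc 1 ⌊x⌋₊, ‖a n‖ * (tau3 n : ℝ)
  set L := Real.log (2 * x / Q) ^ 2
  have hS3 : 0 ≤ S3 := Finset.sum_nonneg fun _ _ => by positivity
  have hT : 0 ≤ ∑ n ∈ Finset.Icc 1 ⌊x⌋₊, ‖a n‖ ^ 2 * (tau n : ℝ) :=
    Finset.sum_nonneg fun _ _ => by positivity
  have hmain := abs_varV_sub_le hQ hQx hxQ (by positivity) hhered
  have hL : 0 ≤ L := sq_nonneg _
  have hS3E : S3 * (1 / Khered * S ^ 2 / S3) ≤ S ^ 2 / Khered := by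
    rcases hS3.eq_or_lt with h0 | hpos
    · rw [← h0, zero_mul]
      positivity
    · exact le_of_eq (by field_simp)
  have hhered' := mul_le_mul_of_nonneg_right hS3E hL
  have hp : 0 ≤ S ^ 2 / Kprog := by positivity
  have hc : 0 ≤ S ^ 2 / Kconc (2 * x / Q) := by positivity
  have hl : 0 ≤ S ^ 2 / Khered * L := by positivity
  have hexpand : S ^ 2 * (1 / Kprog + 1 / Kconc (2 * x / Q) + L / Khered)
      = S ^ 2 / Kprog + S ^ 2 / Kconc (2 * x / Q) + S ^ 2 / Khered * L := by ring
  rw [hexpand]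
  linarith
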